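/- (Lᑫ a priori estimate for the flat Dirac operator) For every q with 1 < q < ∞ there is a constant C, depending only on n and q, such that for every smooth compactly supported spinor field φ : ℝⁿ → V one has Σᵢ ‖∂ᵢφ‖_{Lᑫ(ℝⁿ,V)} ≤ C ‖Dφ‖_{Lᑫ(ℝⁿ,V)}. -/

import Mathlib

open MeasureTheory Metric
open scoped InnerProductSpace

universe u


/-- The flat Dirac operator `Df(x) = ∑ i, γᵢ (∂ᵢ f (x))`. -/
noncomputable def dirac {n : ℕ} {V : Type u} [NormedAddCommGroup V]
    [NormedSpace ℂ V] (γ : Fin n → V →ₗ[ℂ] V)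
    (f : EuclideanSpace ℝ (Fin n) → V) (x : EuclideanSpace ℝ (Fin n)) : V :=
  ∑ i, γ i (fderiv ℝ f x (EuclideanSpace.single i 1))

/-- Euclidean space. -/
abbrev EE (n : ℕ) := EuclideanSpace ℝ (Fin n)

/-- standard basis vector -/
noncomputable abbrev ee {n : ℕ} (i : Fin n) : EE n := EuclideanSpace.single i (1 : ℝ)

/-- partial derivative -/
noncomputable def pd {n : ℕ} {H : Type*} [NormedAddCommGroup H] [NormedSpace ℝ H] (i : Fin n)
    (f : EE n → H) : EE n → H := fun x => fderiv ℝ f x (ee i)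

/-- smooth compactly supported -/
structure CC {n : ℕ} {H : Type*} [NormedAddCommGroup H] [NormedSpace ℝ H]
    (f : EE n → H) : Prop where
  smooth : ContDiff ℝ (⊤ : ℕ∞) f
  supp : HasCompactSupport f

/-- Gaussian -/
noncomputable def gk {n : ℕ} (z : EE n) : ℝ := Real.exp (-Real.pi * ‖z‖ ^ 2)

/-- heat semigroup with time parameter s (t = s^2) -/
noncomputable def heat {n : ℕ} {H : Type*} [NormedAddCommGroup H] [NormedSpace ℝ H] (s : ℝ)
    (f : EE n → H) (x : EE n) : H := ∫ z : EE n, gk z • f (x - s • z)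

section heatsec
variable {n : ℕ} {H : Type*} [NormedAddCommGroup H] [NormedSpace ℝ H]

lemma CC.cont {f : EE n → H} (hf : CC f) : Continuous f := hf.smooth.continuous

lemma CC.diff {f : EE n → H} (hf : CC f) : Differentiable ℝ f :=
  hf.smooth.differentiable (by simp)

lemma CC.pd {f : EE n → H} (hf : CC f) (i : Fin n) : CC (pd i f) := by
  refine ⟨?_, ?_⟩
  · exact (hf.smooth.fderiv_right (m := (⊤ : ℕ∞)) (by simp)).clm_apply contDiff_const
  · exact hf.supp.fderiv_apply ℝ (ee i)

lemma CC.bdd {f : EE n → H} (hf : CC f) : ∃ M : ℝ, 0 ≤ M ∧ ∀ x, ‖f x‖ ≤ M := by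
  obtain ⟨M, hM⟩ := hf.supp.exists_bound_of_continuous hf.cont
  exact ⟨M, (norm_nonneg _).trans (hM 0), hM⟩

lemma CC.int {f : EE n → H} (hf : CC f) : Integrable f :=
  hf.cont.integrable_of_hasCompactSupport hf.supp

lemma gk_pos (z : EE n) : 0 < gk z := Real.exp_pos _

lemma gk_le_one (z : EE n) : gk z ≤ 1 := by
  unfold gk
  rw [Real.exp_le_one_iff]
  have := Real.pi_pos
  nlinarith [sq_nonneg ‖z‖]

lemma gk_cont : Continuous (gk : EE n → ℝ) := by unfold gk; fun_prop

lemma gk_integral : ∫ z : EE n, gk z = 1 := by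
  unfold gk
  rw [GaussianFourier.integral_rexp_neg_mul_sq_norm Real.pi_pos]
  simp

lemma gauss_int {b : ℝ} (hb : 0 < b) : Integrable (fun z : EE n => Real.exp (-b * ‖z‖ ^ 2)) := by
  by_contra h
  have h1 := GaussianFourier.integral_rexp_neg_mul_sq_norm (V := EE n) hb
  rw [integral_undef h] at h1
  have : 0 < (Real.pi / b) ^ (Module.finrank ℝ (EE n) / 2 : ℝ) :=
    Real.rpow_pos_of_pos (div_pos Real.pi_pos hb) _
  linarith

lemma gk_int : Integrable (gk : EE n → ℝ) := gauss_int Real.pi_pos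

lemma gk_mul_int : Integrable (fun z : EE n => ‖z‖ * gk z) := by
  refine (gauss_int (n := n) (b := Real.pi / 2) (by positivity)).mono' ?_ ?_
  · exact (continuous_norm.mul gk_cont).aestronglyMeasurable
  · refine Filter.Eventually.of_forall fun z => ?_
    rw [Real.norm_of_nonneg (mul_nonneg (norm_nonneg _) (gk_pos z).le)]
    unfold gk
    have : Real.exp (-(Real.pi / 2) * ‖z‖ ^ 2)
      = Real.exp (Real.pi / 2 * ‖z‖ ^ 2) * Real.exp (-Real.pi * ‖z‖ ^ 2) := by
      rw [← Real.exp_add]; ring_nf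
    rw [this]
    gcongr
    have h1 := Real.add_one_le_exp (Real.pi / 2 * ‖z‖ ^ 2)
    have h2 := Real.pi_gt_three
    nlinarith [sq_nonneg (‖z‖ - 1), sq_nonneg ‖z‖]

lemma gk_line (z : EE n) (i : Fin n) :
    HasLineDerivAt ℝ gk (-2 * Real.pi * z i * gk z) z (ee i) := by
  have h1 : HasFDerivAt (fun z : EE n => ‖z‖ ^ 2) (2 • innerSL ℝ z) z :=
    (hasStrictFDerivAt_norm_sq z).hasFDerivAt
  have h2 := ((h1.const_mul (-Real.pi)).exp).hasLineDerivAt (ee i)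
  have h3 : (Real.exp (-Real.pi * ‖z‖ ^ 2) • -Real.pi • 2 • (innerSL ℝ) z) (ee i)
      = -2 * Real.pi * z i * gk z := by
    simp [gk, EuclideanSpace.inner_single_right]
    ring
  rw [h3] at h2
  exact h2

lemma heat_int {f : EE n → H} (hf : CC f) (s : ℝ) (x : EE n) :
    Integrable (fun z => gk z • f (x - s • z)) := by
  obtain ⟨M, hM0, hM⟩ := hf.bdd
  have hc := hf.cont
  refine (gk_int.mul_const M).mono' ?_ ?_
  · exact (gk_cont.smul (by fun_prop)).aestronglyMeasurable
  · refine Filter.Eventually.of_forall fun z => ?_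
    rw [norm_smul, Real.norm_of_nonneg (gk_pos z).le]
    exact mul_le_mul_of_nonneg_left (hM _) (gk_pos z).le

lemma heat_le {f : EE n → H} {M : ℝ} (hM : ∀ x, ‖f x‖ ≤ M) (s : ℝ) (x : EE n) :
    ‖heat s f x‖ ≤ M := by
  unfold heat
  calc ‖∫ z : EE n, gk z • f (x - s • z)‖ ≤ ∫ z : EE n, gk z * M := by
        refine norm_integral_le_of_norm_le (gk_int.mul_const M) ?_
        refine Filter.Eventually.of_forall fun z => ?_
        rw [norm_smul, Real.norm_of_nonneg (gk_pos z).le]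
        exact mul_le_mul_of_nonneg_left (hM _) (gk_pos z).le
    _ = M := by rw [integral_mul_const, gk_integral, one_mul]

lemma heat_cont {f : EE n → H} (hf : CC f) :
    Continuous (fun p : ℝ × EE n => heat p.1 f p.2) := by
  obtain ⟨M, hM0, hM⟩ := hf.bdd
  have hc := hf.cont
  unfold heat
  refine continuous_of_dominated (bound := fun z => gk z * M) ?_ ?_ (gk_int.mul_const M) ?_
  · intro p
    exact (heat_int hf p.1 p.2).aestronglyMeasurable
  · intro p
    refine Filter.Eventually.of_forall fun z => ?_
    rw [norm_smul, Real.norm_of_nonneg (gk_pos z).le]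
    exact mul_le_mul_of_nonneg_left (hM _) (gk_pos z).le
  · refine Filter.Eventually.of_forall fun z => ?_
    fun_prop

lemma heat_zero [CompleteSpace H] (f : EE n → H) (x : EE n) : heat 0 f x = f x := by
  simp [heat, integral_smul_const, gk_integral]

lemma heat_line {f : EE n → H} (hf : CC f) (s : ℝ) (x : EE n) (i : Fin n) :
    HasLineDerivAt ℝ (heat s f) (heat s (pd i f) x) x (ee i) := by
  obtain ⟨M, hM0, hM⟩ := (hf.pd i).bdd
  have hc := hf.cont
  unfold HasLineDerivAt
  have := (hasDerivAt_integral_of_dominated_loc_of_deriv_le (μ := (volume : Measure (EE n)))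
    (F := fun (τ : ℝ) z => gk z • f (x + τ • ee i - s • z))
    (F' := fun (τ : ℝ) z => gk z • pd i f (x + τ • ee i - s • z)) (x₀ := (0 : ℝ))
    (s := Set.univ) (bound := fun z => gk z * M) Filter.univ_mem ?_ ?_ ?_ ?_
    (gk_int.mul_const M) ?_).2
  · simpa [heat] using this
  · exact Filter.Eventually.of_forall fun τ => (heat_int hf s _).aestronglyMeasurable
  · exact (heat_int hf s _)
  · exact (heat_int (hf.pd i) s _).aestronglyMeasurable
  · refine Filter.Eventually.of_forall fun z τ _ => ?_
    rw [norm_smul, Real.norm_of_nonneg (gk_pos z).le]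
    exact mul_le_mul_of_nonneg_left (hM _) (gk_pos z).le
  · refine Filter.Eventually.of_forall fun z τ _ => ?_
    have h1 : HasDerivAt (fun τ : ℝ => x + τ • ee i - s • z) (ee i) τ := by
      simpa using (((hasDerivAt_id τ).smul_const (ee i)).const_add x).sub_const (s • z)
    have h2 := (hf.diff (x + τ • ee i - s • z)).hasFDerivAt.comp_hasDerivAt τ h1
    exact h2.const_smul (gk z)

lemma fderiv_sum_pd (f : EE n → H) (y z : EE n) :
    fderiv ℝ f y z = ∑ j, z j • pd j f y := by
  have : z = ∑ j, z j • ee j := by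
    have := (EuclideanSpace.basisFun (Fin n) ℝ).sum_repr z
    simpa using this.symm
  conv_lhs => rw [this]
  simp [pd]

lemma gk_coord_int {f : EE n → H} (hf : CC f) (s : ℝ) (x : EE n) (j : Fin n) :
    Integrable (fun z : EE n => (z j * gk z) • f (x - s • z)) := by
  obtain ⟨M, hM0, hM⟩ := hf.bdd
  have hc := hf.cont
  have hg := gk_cont (n := n)
  refine (gk_mul_int.mul_const M).mono' ?_ ?_
  · exact Continuous.aestronglyMeasurable (by fun_prop)
  · refine Filter.Eventually.of_forall fun z => ?_
    rw [norm_smul, norm_mul, Real.norm_of_nonneg (gk_pos z).le]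
    have := gk_pos z
    have h3 : ‖z j‖ ≤ ‖z‖ := PiLp.norm_apply_le z j
    have h4 := hM (x - s • z)
    gcongr

lemma gk_parts {f : EE n → H} (hf : CC f) (s : ℝ) (x : EE n) (j : Fin n) :
    ∫ z : EE n, (z j * gk z) • f (x - s • z) = -(s / (2 * Real.pi)) • heat s (pd j f) x := by
  have h := integral_bilinear_hasLineDerivAt_right_eq_neg_left_of_integrable
    (μ := (volume : Measure (EE n))) (B := ContinuousLinearMap.lsmul ℝ ℝ)
    (f := (gk : EE n → ℝ)) (f' := fun z => -2 * Real.pi * z j * gk z)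
    (g := fun z => f (x - s • z)) (g' := fun z => (-s) • pd j f (x - s • z)) (v := ee j)
    ?_ ?_ ?_ ?_ ?_
  · simp only [ContinuousLinearMap.lsmul_apply] at h
    have h1 : ∫ z : EE n, gk z • -s • pd j f (x - s • z) = -s • heat s (pd j f) x := by
      unfold heat
      rw [← integral_smul]
      congr 1; ext z; rw [smul_comm]
    have h2 : ∫ z : EE n, (-2 * Real.pi * z j * gk z) • f (x - s • z)
      = (-2 * Real.pi) • ∫ z : EE n, (z j * gk z) • f (x - s • z) := by
      rw [← integral_smul]
      congr 1; ext z; rw [smul_smul]; ring_nf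
    rw [h1, h2] at h
    have hpi := Real.pi_pos
    have h3 : (2 * Real.pi) • ∫ z : EE n, (z j * gk z) • f (x - s • z) = -s • heat s (pd j f) x := by
      rw [h, ← neg_smul]; ring_nf
    have hne : (2 * Real.pi) ≠ 0 := by positivity
    have h4 := (eq_inv_smul_iff₀ hne).2 h3
    rw [h4, smul_smul]; congr 1; field_simp
  · have := (gk_coord_int hf s x j).smul (-2 * Real.pi)
    refine this.congr (Filter.Eventually.of_forall fun z => ?_)
    simp [smul_smul, mul_assoc]
  · have := (heat_int (hf.pd j) s x).smul (-s)
    refine this.congr (Filter.Eventually.of_forall fun z => ?_)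
    simp [smul_comm s]
  · exact heat_int hf s x
  · intro z _; exact gk_line z j
  · intro z _
    unfold HasLineDerivAt
    have h1 : HasDerivAt (fun τ : ℝ => x - s • (z + τ • ee j)) (-s • ee j) 0 := by
      have := ((((hasDerivAt_id (0:ℝ)).smul_const (ee j)).const_add z).const_smul s).const_sub x
      simpa using this
    have h2 := (hf.diff (x - s • (z + (0:ℝ) • ee j))).hasFDerivAt.comp_hasDerivAt 0 h1
    simpa [pd, Function.comp_def] using h2

lemma heat_time {f : EE n → H} (hf : CC f) (s : ℝ) (x : EE n) :
    HasDerivAt (fun s => heat s f x)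
      ((s / (2 * Real.pi)) • ∑ j, heat s (pd j (pd j f)) x) s := by
  have hbd : ∃ M : ℝ, 0 ≤ M ∧ ∀ x, ‖fderiv ℝ f x‖ ≤ M := by
    obtain ⟨M, hM⟩ := (hf.supp.fderiv ℝ).exists_bound_of_continuous
      (hf.smooth.continuous_fderiv (by simp))
    exact ⟨M, (norm_nonneg _).trans (hM 0), hM⟩
  obtain ⟨M, hM0, hM⟩ := hbd
  have hc := hf.cont
  have := (hasDerivAt_integral_of_dominated_loc_of_deriv_le (μ := (volume : Measure (EE n)))
    (F := fun (τ : ℝ) z => gk z • f (x - τ • z))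
    (F' := fun (τ : ℝ) z => gk z • fderiv ℝ f (x - τ • z) (-z)) (x₀ := s)
    (s := Set.univ) (bound := fun z => (‖z‖ * gk z) * M) Filter.univ_mem ?_ ?_ ?_ ?_
    (gk_mul_int.mul_const M) ?_).2
  · unfold heat
    convert this using 1
    have h1 : ∀ z : EE n, gk z • fderiv ℝ f (x - s • z) (-z)
        = ∑ j, -((z j * gk z) • pd j f (x - s • z)) := by
      intro z
      rw [map_neg, fderiv_sum_pd, Finset.sum_neg_distrib, smul_neg, Finset.smul_sum]
      simp only [smul_smul, mul_comm]
    simp_rw [h1]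
    rw [integral_finsetSum]
    · rw [Finset.smul_sum]
      refine Finset.sum_congr rfl fun j _ => ?_
      rw [integral_neg, gk_parts (hf.pd j), neg_smul, neg_neg]; rfl
    · intro j _
      exact (gk_coord_int (hf.pd j) s x j).neg
  · exact Filter.Eventually.of_forall fun τ => (heat_int hf τ _).aestronglyMeasurable
  · exact (heat_int hf s _)
  · have h5 : Continuous (fderiv ℝ f) := hf.smooth.continuous_fderiv (by simp)
    have hg := gk_cont (n := n)
    exact Continuous.aestronglyMeasurable (by fun_prop)
  · refine Filter.Eventually.of_forall fun z τ _ => ?_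
    rw [norm_smul, Real.norm_of_nonneg (gk_pos z).le]
    have := (fderiv ℝ f (x - τ • z)).le_opNorm (-z)
    have h6 := hM (x - τ • z)
    rw [norm_neg] at this
    have := gk_pos z
    calc gk z * ‖fderiv ℝ f (x - τ • z) (-z)‖ ≤ gk z * (M * ‖z‖) := by
          gcongr; exact (by assumption : _ ≤ _).trans (by gcongr)
      _ = _ := by ring
  · refine Filter.Eventually.of_forall fun z τ _ => ?_
    have h1 : HasDerivAt (fun τ : ℝ => x - τ • z) (-z) τ := by
      simpa using ((hasDerivAt_id τ).smul_const z).const_sub x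
    have h2 := (hf.diff (x - τ • z)).hasFDerivAt.comp_hasDerivAt τ h1
    exact h2.const_smul (gk z)

lemma heat_prod_int {f : EE n → H} (hf : CC f) (s : ℝ) :
    Integrable (fun p : EE n × EE n => gk p.2 • f (p.1 - s • p.2)) (volume.prod volume) := by
  have hc := hf.cont
  have hg := gk_cont (n := n)
  rw [integrable_prod_iff' (Continuous.aestronglyMeasurable (by fun_prop))]
  constructor
  · exact Filter.Eventually.of_forall fun z => (hf.int.comp_sub_right (s • z)).smul (gk z)
  · have : ∀ z : EE n, ∫ x : EE n, ‖gk z • f (x - s • z)‖ = gk z * ∫ x, ‖f x‖ := by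
      intro z
      simp_rw [norm_smul, Real.norm_of_nonneg (gk_pos z).le]
      rw [integral_const_mul, integral_sub_right_eq_self (fun x => ‖f x‖)]
    simp_rw [this]
    exact gk_int.mul_const _

lemma heat_L1 {f : EE n → H} (hf : CC f) (s : ℝ) : Integrable (heat s f) :=
  (heat_prod_int hf s).integral_prod_left

lemma heat_L1_le {f : EE n → H} (hf : CC f) (s : ℝ) : ∫ x, ‖heat s f x‖ ≤ ∫ x, ‖f x‖ := by
  have hp := (heat_prod_int hf s).norm
  calc ∫ x, ‖heat s f x‖ ≤ ∫ x, ∫ z, ‖gk z • f (x - s • z)‖ := by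
        refine integral_mono (heat_L1 hf s).norm hp.integral_prod_left fun x => ?_
        exact norm_integral_le_integral_norm _
    _ = ∫ z : EE n, ∫ x, ‖gk z • f (x - s • z)‖ := integral_integral_swap hp
    _ = ∫ z : EE n, gk z * ∫ x, ‖f x‖ := by
        congr 1; ext z
        simp_rw [norm_smul, Real.norm_of_nonneg (gk_pos z).le]
        rw [integral_const_mul, integral_sub_right_eq_self (fun x => ‖f x‖)]
    _ = _ := by rw [integral_mul_const, gk_integral, one_mul]

lemma heat_decay {f : EE n → H} (hf : CC f) {s : ℝ} (hs : 0 < s) (x : EE n) :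
    ‖heat s f x‖ ≤ (s ^ n)⁻¹ * ∫ y, ‖f y‖ := by
  have h0 : Integrable (fun z : EE n => ‖f (x - s • z)‖) := by
    have h1 : Integrable (fun z : EE n => f (x - z)) := hf.int.comp_sub_left x
    exact (h1.comp_smul hs.ne').norm
  calc ‖heat s f x‖ ≤ ∫ z : EE n, ‖f (x - s • z)‖ := by
        refine norm_integral_le_of_norm_le h0 (Filter.Eventually.of_forall fun z => ?_)
        rw [norm_smul, Real.norm_of_nonneg (gk_pos z).le]
        exact mul_le_of_le_one_left (norm_nonneg _) (gk_le_one z)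
    _ = _ := by
      rw [Measure.integral_comp_smul volume (fun z : EE n => ‖f (x - z)‖) s,
        integral_sub_left_eq_self (fun z => ‖f z‖)]
      simp [abs_of_pos hs]

lemma heat_ST {f : EE n → H} (hf : CC f) (S : ℝ) :
    Integrable (fun p : ℝ × EE n => heat p.1 f p.2)
      ((volume.restrict (Set.uIoc 0 S)).prod volume) := by
  have hm : AEStronglyMeasurable (fun p : ℝ × EE n => heat p.1 f p.2)
      ((volume.restrict (Set.uIoc 0 S)).prod volume) := (heat_cont hf).aestronglyMeasurable
  rw [integrable_prod_iff hm]
  refine ⟨Filter.Eventually.of_forall fun s => heat_L1 hf s, ?_⟩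
  have : IsFiniteMeasure (volume.restrict (Set.uIoc 0 S)) := by
    unfold Set.uIoc; infer_instance
  refine Integrable.mono' (integrable_const (∫ x, ‖f x‖)) hm.norm.integral_prod_right' ?_
  refine Filter.Eventually.of_forall fun s => ?_
  rw [Real.norm_of_nonneg (integral_nonneg fun _ => norm_nonneg _)]
  exact heat_L1_le hf s
end heatsec


section bellman

/-- Bellman function -/
noncomputable def BF (r κ K a b : ℝ) : ℝ := a * (a ^ r + b) ^ κ + K * b ^ (1 - κ)
/-- derivative in a -/
noncomputable def BA (r κ a b : ℝ) : ℝ :=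
  (a ^ r + b) ^ κ + a * (κ * (a ^ r + b) ^ (κ - 1) * (r * a ^ (r - 1)))
/-- derivative in b -/
noncomputable def BB (r κ K a b : ℝ) : ℝ :=
  a * (κ * (a ^ r + b) ^ (κ - 1)) + K * ((1 - κ) * b ^ (-κ))
/-- second derivative -/
noncomputable def BAA (r κ a b : ℝ) : ℝ :=
  2 * (κ * (a ^ r + b) ^ (κ - 1) * (r * a ^ (r - 1)))
    + a * κ * ((κ - 1) * (a ^ r + b) ^ (κ - 2) * (r * a ^ (r - 1)) * (r * a ^ (r - 1))
      + (a ^ r + b) ^ (κ - 1) * (r * ((r - 1) * a ^ (r - 2))))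
/-- second derivative -/
noncomputable def BAB (r κ a b : ℝ) : ℝ :=
  κ * (a ^ r + b) ^ (κ - 1) + a * (κ * ((κ - 1) * (a ^ r + b) ^ (κ - 2) * (r * a ^ (r - 1))))
/-- second derivative -/
noncomputable def BBB (r κ K a b : ℝ) : ℝ :=
  a * (κ * ((κ - 1) * (a ^ r + b) ^ (κ - 2))) + K * ((1 - κ) * (-κ * b ^ (-κ - 1)))

variable {r κ K : ℝ} {a b : ℝ → ℝ} {a' b' t : ℝ}

lemma hm_deriv (ha : HasDerivAt a a' t) (hb : HasDerivAt b b' t) (ha0 : 0 < a t) (hb0 : 0 < b t)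
    (e : ℝ) : HasDerivAt (fun t => (a t ^ r + b t) ^ e)
      (e * (a t ^ r + b t) ^ (e - 1) * (r * a t ^ (r - 1)) * a'
        + e * (a t ^ r + b t) ^ (e - 1) * b') t := by
  have h1 := ha.rpow_const (p := r) (Or.inl ha0.ne')
  have h2 := (h1.add hb).rpow_const (p := e)
    (Or.inl (by have := Real.rpow_pos_of_pos ha0 r; simp only [Pi.add_apply]; positivity))
  refine h2.congr_deriv ?_
  change (a' * r * a t ^ (r - 1) + b') * e * (a t ^ r + b t) ^ (e - 1) = _
  ring

lemma BF_deriv (ha : HasDerivAt a a' t) (hb : HasDerivAt b b' t) (ha0 : 0 < a t) (hb0 : 0 < b t) :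
    HasDerivAt (fun t => BF r κ K (a t) (b t))
      (BA r κ (a t) (b t) * a' + BB r κ K (a t) (b t) * b') t := by
  have h1 := hm_deriv (r := r) ha hb ha0 hb0 κ
  have h2 := (hb.rpow_const (p := 1 - κ) (Or.inl hb0.ne')).const_mul K
  refine ((ha.mul h1).add h2).congr_deriv ?_
  unfold BA BB
  rw [show 1 - κ - 1 = -κ by ring]
  ring

lemma BA_deriv (ha : HasDerivAt a a' t) (hb : HasDerivAt b b' t) (ha0 : 0 < a t) (hb0 : 0 < b t) :
    HasDerivAt (fun t => BA r κ (a t) (b t))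
      (BAA r κ (a t) (b t) * a' + BAB r κ (a t) (b t) * b') t := by
  have h1 := hm_deriv (r := r) ha hb ha0 hb0 κ
  have h2 := (hm_deriv (r := r) ha hb ha0 hb0 (κ - 1)).const_mul κ
  have h3 := (ha.rpow_const (p := r - 1) (Or.inl ha0.ne')).const_mul r
  refine (h1.add (ha.mul (h2.mul h3))).congr_deriv ?_
  unfold BAA BAB
  rw [show r - 1 - 1 = r - 2 by ring, show κ - 1 - 1 = κ - 2 by ring]
  simp only [Pi.mul_apply]
  ring

lemma BB_deriv (ha : HasDerivAt a a' t) (hb : HasDerivAt b b' t) (ha0 : 0 < a t) (hb0 : 0 < b t) :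
    HasDerivAt (fun t => BB r κ K (a t) (b t))
      (BAB r κ (a t) (b t) * a' + BBB r κ K (a t) (b t) * b') t := by
  have h2 := (hm_deriv (r := r) ha hb ha0 hb0 (κ - 1)).const_mul κ
  have h3 := ((hb.rpow_const (p := -κ) (Or.inl hb0.ne')).const_mul (1 - κ)).const_mul K
  refine ((ha.mul h2).add h3).congr_deriv ?_
  unfold BAB BBB
  rw [show κ - 1 - 1 = κ - 2 by ring]
  ring

lemma B_cont_aux (r e : ℝ) : ContinuousOn (fun p : ℝ × ℝ => (p.1 ^ r + p.2) ^ e)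
    (Set.Ioi 0 ×ˢ Set.Ioi 0) := by
  refine ContinuousOn.rpow_const ?_ ?_
  · refine ContinuousOn.add (ContinuousOn.rpow_const continuousOn_fst ?_) continuousOn_snd
    rintro ⟨x, y⟩ ⟨hx, hy⟩
    exact Or.inl (ne_of_gt hx)
  · rintro ⟨x, y⟩ ⟨hx, hy⟩
    have hx' : 0 < x := hx
    have hy' : 0 < y := hy
    left
    have := Real.rpow_pos_of_pos hx' r
    simp only
    positivity

lemma B_cont_a (e : ℝ) : ContinuousOn (fun p : ℝ × ℝ => p.1 ^ e) (Set.Ioi 0 ×ˢ Set.Ioi 0) := by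
  refine ContinuousOn.rpow_const continuousOn_fst ?_
  rintro ⟨x, y⟩ ⟨hx, hy⟩
  exact Or.inl (ne_of_gt hx)

lemma B_cont_b (e : ℝ) : ContinuousOn (fun p : ℝ × ℝ => p.2 ^ e) (Set.Ioi 0 ×ˢ Set.Ioi 0) := by
  refine ContinuousOn.rpow_const continuousOn_snd ?_
  rintro ⟨x, y⟩ ⟨hx, hy⟩
  exact Or.inl (ne_of_gt hy)

lemma BA_cont : ContinuousOn (fun p : ℝ × ℝ => BA r κ p.1 p.2) (Set.Ioi 0 ×ˢ Set.Ioi 0) := by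
  have h1 := B_cont_aux r κ
  have h2 := B_cont_aux r (κ - 1)
  have h3 := B_cont_a (r - 1)
  unfold BA
  fun_prop

lemma BB_cont : ContinuousOn (fun p : ℝ × ℝ => BB r κ K p.1 p.2) (Set.Ioi 0 ×ˢ Set.Ioi 0) := by
  have h2 := B_cont_aux r (κ - 1)
  have h3 := B_cont_b (-κ)
  unfold BB
  fun_prop

lemma BAA_cont : ContinuousOn (fun p : ℝ × ℝ => BAA r κ p.1 p.2) (Set.Ioi 0 ×ˢ Set.Ioi 0) := by
  have h1 := B_cont_aux r (κ - 2)
  have h2 := B_cont_aux r (κ - 1)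
  have h3 := B_cont_a (r - 1)
  have h4 := B_cont_a (r - 2)
  unfold BAA
  fun_prop

lemma BAB_cont : ContinuousOn (fun p : ℝ × ℝ => BAB r κ p.1 p.2) (Set.Ioi 0 ×ˢ Set.Ioi 0) := by
  have h1 := B_cont_aux r (κ - 2)
  have h2 := B_cont_aux r (κ - 1)
  have h3 := B_cont_a (r - 1)
  unfold BAB
  fun_prop

lemma BBB_cont : ContinuousOn (fun p : ℝ × ℝ => BBB r κ K p.1 p.2) (Set.Ioi 0 ×ˢ Set.Ioi 0) := by
  have h1 := B_cont_aux r (κ - 2)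
  have h3 := B_cont_b (-κ - 1)
  unfold BBB
  fun_prop

lemma BF_mono {a b a₁ b₁ : ℝ} (hr : 1 ≤ r) (hκ : 0 ≤ κ) (hκ' : κ ≤ 1) (hK : 0 ≤ K)
    (ha : 0 < a) (hb : 0 < b) (h1 : a ≤ a₁) (h2 : b ≤ b₁) : BF r κ K a b ≤ BF r κ K a₁ b₁ := by
  unfold BF
  have : 0 ≤ 1 - κ := by linarith
  have : 0 ≤ a₁ := by linarith
  gcongr

lemma BF_growth {a b : ℝ} (hr : 1 ≤ r) (hκ : κ = (1 - 1 / r) / 2) (hK : 0 ≤ K)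
    (ha : 0 < a) (hb : 0 < b) :
    BF r κ K a b ≤ (2 + K) * (a ^ ((r + 1) / 2) + b ^ (1 - κ)) := by
  have hr0 : 0 < r := by linarith
  have hi : 1 / r ≤ 1 := by rw [div_le_one hr0]; exact hr
  have hi0 : 0 < 1 / r := by positivity
  have hκ0 : 0 ≤ κ := by rw [hκ]; linarith
  have hκ1 : κ ≤ 1 := by rw [hκ]; linarith
  have har := Real.rpow_pos_of_pos ha r
  have hA := Real.rpow_pos_of_pos ha ((r + 1) / 2)
  have hB := Real.rpow_pos_of_pos hb (1 - κ)
  have h2κ : (2 : ℝ) ^ κ ≤ 2 := by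
    calc (2 : ℝ) ^ κ ≤ 2 ^ (1 : ℝ) := Real.rpow_le_rpow_of_exponent_le (by norm_num) hκ1
      _ = 2 := by norm_num
  have key : a * (a ^ r + b) ^ κ ≤ 2 * (a ^ ((r + 1) / 2) + b ^ (1 - κ)) := by
    rcases le_total (a ^ r) b with h | h
    · have ha' : a ≤ b ^ (1 / r) := by
        calc a = (a ^ r) ^ (1 / r) := by
              rw [← Real.rpow_mul ha.le, mul_one_div_cancel hr0.ne', Real.rpow_one]
          _ ≤ b ^ (1 / r) := by gcongr
      calc a * (a ^ r + b) ^ κ ≤ b ^ (1 / r) * (2 * b) ^ κ := by gcongr; linarith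
        _ = 2 ^ κ * (b ^ (1 / r) * b ^ κ) := by rw [Real.mul_rpow (by norm_num) hb.le]; ring
        _ = 2 ^ κ * b ^ (1 - κ) := by
            rw [← Real.rpow_add hb]; congr 2; rw [hκ]; ring
        _ ≤ 2 * b ^ (1 - κ) := by gcongr
        _ ≤ _ := by linarith
    · calc a * (a ^ r + b) ^ κ ≤ a * (2 * a ^ r) ^ κ := by gcongr; linarith
        _ = 2 ^ κ * (a ^ (1 : ℝ) * a ^ (r * κ)) := by
            rw [Real.mul_rpow (by norm_num) har.le, Real.rpow_mul ha.le, Real.rpow_one]; ring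
        _ = 2 ^ κ * a ^ ((r + 1) / 2) := by
            rw [← Real.rpow_add ha]; congr 2; rw [hκ]; field_simp; ring
        _ ≤ 2 * a ^ ((r + 1) / 2) := by gcongr
        _ ≤ _ := by linarith
  unfold BF
  nlinarith [mul_nonneg hK hA.le]

set_option maxHeartbeats 1000000 in
lemma BF_quad {a b α β A B : ℝ} (hr : 1 ≤ r) (hκ : κ = (1 - 1 / r) / 2)
    (hK : K = r * (4 * r ^ 2 + 2)) (ha : 0 < a) (hb : 0 < b) (hα : 0 ≤ α) (hβ : 0 ≤ β)
    (hA : |A| ≤ 2 * √a * α) (hB : |B| ≤ 2 * √b * β) :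
    (a ^ r + b) ^ κ * α ^ 2 + b ^ (-κ) * β ^ 2 ≤
      BAA r κ a b * A ^ 2 + 2 * BAB r κ a b * (A * B) + BBB r κ K a b * B ^ 2
        + 2 * BA r κ a b * α ^ 2 + 2 * BB r κ K a b * β ^ 2 := by
  have hr0 : 0 < r := by linarith
  have hi : 1 / r ≤ 1 := by rw [div_le_one hr0]; exact hr
  have hi0 : 0 < 1 / r := by positivity
  have hκ0 : 0 ≤ κ := by rw [hκ]; linarith
  have hκ1 : κ < 1 / 2 := by rw [hκ]; linarith
  have har := Real.rpow_pos_of_pos ha r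
  set m := a ^ r + b with hm
  have hm0 : 0 < m := by positivity
  have ham : a ^ r ≤ m := by linarith
  have hbm : b ≤ m := by linarith
  have hX := Real.rpow_pos_of_pos hm0 κ
  have hY := Real.rpow_pos_of_pos hb (-κ)
  have hm1 : m ^ (κ - 1) = m ^ κ / m := by rw [Real.rpow_sub_one hm0.ne']
  have hm2 : m ^ (κ - 2) = m ^ κ / m ^ 2 := by
    rw [show κ - 2 = κ - (2 : ℕ) by norm_num, Real.rpow_sub_natCast hm0.ne']
  have ha1 : a ^ (r - 1) = a ^ r / a := by rw [Real.rpow_sub_one ha.ne']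
  have ha2 : a ^ (r - 2) = a ^ r / a ^ 2 := by
    rw [show r - 2 = r - (2 : ℕ) by norm_num, Real.rpow_sub_natCast ha.ne']
  have hb1 : b ^ (-κ - 1) = b ^ (-κ) / b := by rw [Real.rpow_sub_one hb.ne']
  -- key: a * X ≤ Y * m
  have hkey : a * m ^ κ ≤ b ^ (-κ) * m := by
    have h1 : a ≤ m ^ (1 - 2 * κ) := by
      calc a = (a ^ r) ^ (1 / r) := by
            rw [← Real.rpow_mul ha.le, mul_one_div_cancel hr0.ne', Real.rpow_one]
        _ ≤ m ^ (1 / r) := by gcongr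
        _ = _ := by congr 1; rw [hκ]; ring
    have h2 : m ^ (-κ) ≤ b ^ (-κ) := Real.rpow_le_rpow_of_nonpos hb hbm (by linarith)
    calc a * m ^ κ ≤ m ^ (1 - 2 * κ) * m ^ κ := by gcongr
      _ = m ^ (-κ) * m ^ (1 : ℝ) := by rw [← Real.rpow_add hm0, ← Real.rpow_add hm0]; congr 1; ring
      _ ≤ b ^ (-κ) * m := by rw [Real.rpow_one]; gcongr
  set X := m ^ κ with hXd
  set Y := b ^ (-κ) with hYd
  set θ := a ^ r / m with hθ
  have hθ0 : 0 < θ := by positivity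
  have hθ1 : θ ≤ 1 := by rw [hθ, div_le_one hm0]; exact ham
  -- BAA ≥ 0
  have eAA : BAA r κ a b = κ * r * X * θ / a * (2 + (r - 1) - (1 - κ) * r * θ) := by
    unfold BAA
    rw [← hm, hm1, hm2, ha1, ha2, hθ]
    field_simp
    ring
  have hAA : 0 ≤ BAA r κ a b := by
    rw [eAA]
    have : 0 ≤ 2 + (r - 1) - (1 - κ) * r * θ := by
      have : (1 - κ) * r * θ ≤ 1 * r * 1 := by
        gcongr <;> linarith
      linarith
    positivity
  have eAB : BAB r κ a b = κ * X / m * (1 - (1 - κ) * r * θ) := by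
    unfold BAB
    rw [← hm, hm1, hm2, ha1, hθ]
    field_simp
    ring
  have hAB : |BAB r κ a b| ≤ κ * X / m * r := by
    rw [eAB, abs_mul, abs_of_nonneg (by positivity : 0 ≤ κ * X / m)]
    have : 0 ≤ (1 - κ) * r * θ := by
      have : 0 ≤ 1 - κ := by linarith
      positivity
    have h2 : (1 - κ) * r * θ ≤ 1 * r * 1 := by gcongr <;> linarith
    gcongr
    rw [abs_le]; constructor <;> linarith
  have hBA : X ≤ BA r κ a b := by
    unfold BA
    rw [← hm]
    have : 0 ≤ a * (κ * m ^ (κ - 1) * (r * a ^ (r - 1))) := by positivity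
    linarith
  have eBB : K * (1 - κ) * Y ≤ BB r κ K a b := by
    unfold BB
    rw [← hm]
    have : 0 ≤ a * (κ * m ^ (κ - 1)) := by positivity
    linarith
  have eBBB : BBB r κ K a b = -(κ * (1 - κ) * (a * X / m ^ 2) + K * (1 - κ) * κ * (Y / b)) := by
    unfold BBB
    rw [← hm, hm2, hb1]
    ring
  have hsa : √a ^ 2 = a := Real.sq_sqrt ha.le
  have hsb : √b ^ 2 = b := Real.sq_sqrt hb.le
  have hB2 : B ^ 2 ≤ 4 * b * β ^ 2 := by
    rw [← sq_abs]
    calc |B| ^ 2 ≤ (2 * √b * β) ^ 2 := by gcongr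
      _ = 4 * b * β ^ 2 := by rw [mul_pow, mul_pow, hsb]; ring
  have hk1 : a * X / m ^ 2 * b ≤ Y := by
    rw [div_mul_eq_mul_div, div_le_iff₀ (by positivity)]
    calc a * X * b ≤ (Y * m) * m := by gcongr
      _ = _ := by ring
  have hK0 : 0 < K := by rw [hK]; positivity
  have h1κ : 0 < 1 - κ := by linarith
  have tBBB : -(4 * κ * (1 - κ) * Y * β ^ 2 + 4 * K * (1 - κ) * κ * Y * β ^ 2)
      ≤ BBB r κ K a b * B ^ 2 := by
    rw [eBBB, neg_mul, neg_le_neg_iff]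
    calc (κ * (1 - κ) * (a * X / m ^ 2) + K * (1 - κ) * κ * (Y / b)) * B ^ 2
        ≤ (κ * (1 - κ) * (a * X / m ^ 2) + K * (1 - κ) * κ * (Y / b)) * (4 * b * β ^ 2) := by
          gcongr
      _ = 4 * κ * (1 - κ) * (a * X / m ^ 2 * b) * β ^ 2 + 4 * K * (1 - κ) * κ * Y * β ^ 2 := by
          field_simp
      _ ≤ _ := by gcongr
  have tAB : -(X * α ^ 2 + 16 * (κ * r) ^ 2 * Y * β ^ 2) ≤ 2 * BAB r κ a b * (A * B) := by
    have h1 : |2 * BAB r κ a b * (A * B)| ≤ 8 * (κ * r) * (X / m * √a * √b) * (α * β) := by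
      rw [abs_mul, abs_mul, abs_mul, abs_two]
      calc 2 * |BAB r κ a b| * (|A| * |B|)
          ≤ 2 * (κ * X / m * r) * ((2 * √a * α) * (2 * √b * β)) := by gcongr
        _ = _ := by ring
    have h2 : (X / m * √a * √b) ^ 2 ≤ X * Y := by
      rw [mul_pow, mul_pow, hsa, hsb]
      calc (X / m) ^ 2 * a * b = X * (a * X / m ^ 2 * b) := by field_simp
        _ ≤ X * Y := by gcongr
    set Z := X / m * √a * √b with hZ
    have hZ0 : 0 ≤ Z := by positivity
    have h3 : 8 * (κ * r) * Z * (α * β) ≤ X * α ^ 2 + 16 * (κ * r) ^ 2 * Y * β ^ 2 := by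
      have h4 : Z ≤ √X * √Y := by
        rw [← Real.sqrt_mul hX.le]
        exact Real.le_sqrt_of_sq_le h2
      have h5 : √X ^ 2 = X := Real.sq_sqrt hX.le
      have h6 : √Y ^ 2 = Y := Real.sq_sqrt hY.le
      calc 8 * (κ * r) * Z * (α * β) ≤ 8 * (κ * r) * (√X * √Y) * (α * β) := by gcongr
        _ = 2 * (√X * α) * (4 * (κ * r) * √Y * β) := by ring
        _ ≤ (√X * α) ^ 2 + (4 * (κ * r) * √Y * β) ^ 2 := two_mul_le_add_sq _ _
        _ = _ := by rw [← h5, ← h6]; simp only [Real.sqrt_sq (Real.sqrt_nonneg _)]; ring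
    have := neg_abs_le (2 * BAB r κ a b * (A * B))
    linarith
  have tAA : 0 ≤ BAA r κ a b * A ^ 2 := by positivity
  have tBA : 2 * X * α ^ 2 ≤ 2 * BA r κ a b * α ^ 2 := by gcongr
  have tBB : 2 * (K * (1 - κ) * Y) * β ^ 2 ≤ 2 * BB r κ K a b * β ^ 2 := by gcongr
  have hcoef : 1 ≤ 2 * (K * (1 - κ)) - 4 * κ * (1 - κ) - 4 * K * (1 - κ) * κ - 16 * (κ * r) ^ 2 := by
    have e1 : 2 * (K * (1 - κ)) - 4 * K * (1 - κ) * κ = 2 * (4 * r ^ 2 + 2) * (1 - κ) := by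
      have : 2 - 4 * κ = 2 / r := by rw [hκ]; ring
      calc _ = K * (1 - κ) * (2 - 4 * κ) := by ring
        _ = _ := by rw [this, hK]; field_simp
    have e2 : (κ * r) ^ 2 ≤ (1 / 2 * r) ^ 2 := by gcongr
    have e3 : 4 * κ * (1 - κ) ≤ 1 := by have := sq_nonneg (1 - 2 * κ); ring_nf at this ⊢; linarith
    have e4 : (4 * r ^ 2 + 2) ≤ 2 * (4 * r ^ 2 + 2) * (1 - κ) := by
      have : (4 * r ^ 2 + 2) * 1 ≤ (4 * r ^ 2 + 2) * (2 * (1 - κ)) := by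
        gcongr; linarith
      linarith
    linarith
  have hYβ : 0 ≤ Y * β ^ 2 := by positivity
  have := mul_le_mul_of_nonneg_right hcoef hYβ
  linarith

lemma BF_prod {a b : ℝ} (hκ : 0 ≤ κ) (ha : 0 < a) (hb : 0 < b) (α β : ℝ) :
    2 * (α * β) ≤ (a ^ r + b) ^ κ * α ^ 2 + b ^ (-κ) * β ^ 2 := by
  have har := Real.rpow_pos_of_pos ha r
  have hY := Real.rpow_pos_of_pos hb κ
  have h1 : b ^ κ ≤ (a ^ r + b) ^ κ := by gcongr; linarith
  rw [Real.rpow_neg hb.le]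
  have h2 : b ^ κ * α ^ 2 ≤ (a ^ r + b) ^ κ * α ^ 2 := by gcongr
  refine le_trans ?_ (add_le_add_left h2 _)
  set y := b ^ κ
  have h3 : y * α ^ 2 + y⁻¹ * β ^ 2 - 2 * (α * β) = y⁻¹ * (y * α - β) ^ 2 := by
    field_simp
    ring
  have : 0 ≤ y⁻¹ * (y * α - β) ^ 2 := by positivity
  linarith
end bellman


section embed
variable {n : ℕ} {H : Type*} [NormedAddCommGroup H] [InnerProductSpace ℝ H]

/-- bounded continuous -/
structure BC {W : Type*} [NormedAddCommGroup W] (c : ℝ × EE n → W) : Prop where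
  cont : Continuous c
  bdd : ∃ C : ℝ, 0 ≤ C ∧ ∀ p, ‖c p‖ ≤ C

lemma BC.const {W : Type*} [NormedAddCommGroup W] (w : W) : BC (fun _ : ℝ × EE n => w) :=
  ⟨continuous_const, ‖w‖, norm_nonneg _, fun _ => le_rfl⟩

lemma BC.add {c d : ℝ × EE n → ℝ} (hc : BC c) (hd : BC d) : BC (fun p => c p + d p) := by
  obtain ⟨C, hC0, hC⟩ := hc.bdd
  obtain ⟨D, hD0, hD⟩ := hd.bdd
  exact ⟨hc.cont.add hd.cont, C + D, by positivity,
    fun p => (norm_add_le _ _).trans (add_le_add (hC p) (hD p))⟩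

lemma BC.mul {c d : ℝ × EE n → ℝ} (hc : BC c) (hd : BC d) : BC (fun p => c p * d p) := by
  obtain ⟨C, hC0, hC⟩ := hc.bdd
  obtain ⟨D, hD0, hD⟩ := hd.bdd
  refine ⟨hc.cont.mul hd.cont, C * D, by positivity, fun p => ?_⟩
  rw [norm_mul]
  exact mul_le_mul (hC p) (hD p) (norm_nonneg _) hC0

lemma BC.inner {c d : ℝ × EE n → H} (hc : BC c) (hd : BC d) : BC (fun p => inner ℝ (c p) (d p)) := by
  obtain ⟨C, hC0, hC⟩ := hc.bdd
  obtain ⟨D, hD0, hD⟩ := hd.bdd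
  refine ⟨hc.cont.inner hd.cont, C * D, by positivity, fun p => ?_⟩
  exact (norm_inner_le_norm _ _).trans (mul_le_mul (hC p) (hD p) (norm_nonneg _) hC0)

lemma BC.heat {f : EE n → H} (hf : CC f) : BC (fun p : ℝ × EE n => heat p.1 f p.2) := by
  obtain ⟨M, hM0, hM⟩ := hf.bdd
  exact ⟨heat_cont hf, M, hM0, fun p => heat_le hM _ _⟩

lemma BC.comp {Θ : ℝ × ℝ → ℝ} (hΘ : ContinuousOn Θ (Set.Ioi 0 ×ˢ Set.Ioi 0)) {u v : ℝ × EE n → H}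
    (hu : BC u) (hv : BC v) {e : ℝ} (he : 0 < e) :
    BC (fun p => Θ (e + ‖u p‖ ^ 2, e + ‖v p‖ ^ 2)) := by
  obtain ⟨C, hC0, hC⟩ := hu.bdd
  obtain ⟨D, hD0, hD⟩ := hv.bdd
  have hcu := hu.cont
  have hcv := hv.cont
  refine ⟨?_, ?_⟩
  · refine hΘ.comp_continuous (by fun_prop) fun p => ?_
    exact ⟨by simp only [Set.mem_Ioi]; positivity, by simp only [Set.mem_Ioi]; positivity⟩
  · have hk : IsCompact (Set.Icc e (e + C ^ 2) ×ˢ Set.Icc e (e + D ^ 2)) :=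
      isCompact_Icc.prod isCompact_Icc
    obtain ⟨B, hB⟩ := hk.exists_bound_of_continuousOn (hΘ.mono (by
      rintro ⟨x, y⟩ ⟨hx, hy⟩
      exact ⟨lt_of_lt_of_le he hx.1, lt_of_lt_of_le he hy.1⟩))
    have h1 : ∀ p, ‖Θ (e + ‖u p‖ ^ 2, e + ‖v p‖ ^ 2)‖ ≤ B := by
      intro p
      refine hB _ ⟨⟨by simp only; nlinarith [sq_nonneg ‖u p‖], ?_⟩, ⟨by simp only; nlinarith [sq_nonneg ‖v p‖], ?_⟩⟩
      · have := hC p; simp only; gcongr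
      · have := hD p; simp only; gcongr
    exact ⟨B, (norm_nonneg _).trans (h1 0), h1⟩

lemma term_int {c : ℝ × EE n → ℝ} {u : ℝ × EE n → H} {v : EE n → H} (hc : BC c) (hu : BC u)
    (hv : CC v) (s : ℝ) : Integrable (fun x => c (s, x) * inner ℝ (u (s, x)) (heat s v x)) := by
  obtain ⟨C, hC0, hC⟩ := hc.bdd
  obtain ⟨D, hD0, hD⟩ := hu.bdd
  have hcu := hu.cont
  have hcc := hc.cont
  have hcv : Continuous (fun x => heat s v x) := (heat_cont hv).comp (by fun_prop : Continuous fun x : EE n => (s, x))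
  refine ((heat_L1 hv s).norm.const_mul (C * D)).mono' ?_ ?_
  · exact Continuous.aestronglyMeasurable (by fun_prop)
  · refine Filter.Eventually.of_forall fun x => ?_
    rw [norm_mul]
    calc ‖c (s, x)‖ * ‖inner ℝ (u (s, x)) (heat s v x)‖ ≤ C * (D * ‖heat s v x‖) := by
          refine mul_le_mul (hC _) ((norm_inner_le_norm _ _).trans ?_) (norm_nonneg _) hC0
          exact mul_le_mul_of_nonneg_right (hD _) (norm_nonneg _)
      _ = _ := by ring

lemma term_ST {c : ℝ × EE n → ℝ} {u : ℝ × EE n → H} {v : EE n → H} (hc : BC c) (hu : BC u)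
    (hv : CC v) (S : ℝ) : Integrable (fun p : ℝ × EE n => c p * inner ℝ (u p) (heat p.1 v p.2))
      ((volume.restrict (Set.uIoc 0 S)).prod volume) := by
  obtain ⟨C, hC0, hC⟩ := hc.bdd
  obtain ⟨D, hD0, hD⟩ := hu.bdd
  have hcu := hu.cont
  have hcc := hc.cont
  have hcv := heat_cont hv
  refine ((heat_ST hv S).norm.const_mul (C * D)).mono' ?_ ?_
  · exact Continuous.aestronglyMeasurable (by fun_prop)
  · refine Filter.Eventually.of_forall fun p => ?_
    rw [norm_mul]
    calc ‖c p‖ * ‖inner ℝ (u p) (heat p.1 v p.2)‖ ≤ C * (D * ‖heat p.1 v p.2‖) := by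
          refine mul_le_mul (hC _) ((norm_inner_le_norm _ _).trans ?_) (norm_nonneg _) hC0
          exact mul_le_mul_of_nonneg_right (hD _) (norm_nonneg _)
      _ = _ := by ring

lemma time_ST {k : ℝ × EE n → ℝ} {S : ℝ}
    (hk : Integrable k ((volume.restrict (Set.uIoc 0 S)).prod volume)) :
    Integrable (fun p : ℝ × EE n => p.1 * k p) ((volume.restrict (Set.uIoc 0 S)).prod volume) := by
  refine hk.bdd_mul (c := |S|) continuous_fst.aestronglyMeasurable ?_
  have : (volume.restrict (Set.uIoc 0 S)).prod (volume : Measure (EE n))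
      = (volume.prod volume).restrict (Set.uIoc 0 S ×ˢ Set.univ) := by
    rw [← Measure.prod_restrict, Measure.restrict_univ]
  rw [this]
  refine ae_restrict_of_forall_mem (measurableSet_uIoc.prod MeasurableSet.univ) ?_
  rintro ⟨s, x⟩ ⟨hs, -⟩
  have := Set.abs_sub_left_of_mem_uIcc (Set.uIoc_subset_uIcc hs)
  simpa using this

lemma h_line {r κ K e : ℝ} (he : 0 < e) {F G : EE n → H} {F' G' : H} {x v : EE n}
    (hF : HasLineDerivAt ℝ F F' x v) (hG : HasLineDerivAt ℝ G G' x v) :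
    HasLineDerivAt ℝ (fun x => BF r κ K (e + ‖F x‖ ^ 2) (e + ‖G x‖ ^ 2))
      (BA r κ (e + ‖F x‖ ^ 2) (e + ‖G x‖ ^ 2) * (2 * inner ℝ (F x) F')
        + BB r κ K (e + ‖F x‖ ^ 2) (e + ‖G x‖ ^ 2) * (2 * inner ℝ (G x) G')) x v := by
  unfold HasLineDerivAt at *
  have h1 := (hF.norm_sq).const_add e
  have h2 := (hG.norm_sq).const_add e
  have := BF_deriv (r := r) (κ := κ) (K := K) h1 h2 (by positivity) (by positivity)
  simpa using this

lemma hj_line {r κ K e : ℝ} (he : 0 < e) {F G F1 G1 : EE n → H} {F2 G2 : H} {x v : EE n}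
    (hF : HasLineDerivAt ℝ F (F1 x) x v) (hG : HasLineDerivAt ℝ G (G1 x) x v)
    (hF1 : HasLineDerivAt ℝ F1 F2 x v) (hG1 : HasLineDerivAt ℝ G1 G2 x v) :
    HasLineDerivAt ℝ (fun x => BA r κ (e + ‖F x‖ ^ 2) (e + ‖G x‖ ^ 2) * (2 * inner ℝ (F x) (F1 x))
        + BB r κ K (e + ‖F x‖ ^ 2) (e + ‖G x‖ ^ 2) * (2 * inner ℝ (G x) (G1 x)))
      ((BAA r κ (e + ‖F x‖ ^ 2) (e + ‖G x‖ ^ 2) * (2 * inner ℝ (F x) (F1 x))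
        + BAB r κ (e + ‖F x‖ ^ 2) (e + ‖G x‖ ^ 2) * (2 * inner ℝ (G x) (G1 x)))
          * (2 * inner ℝ (F x) (F1 x))
        + BA r κ (e + ‖F x‖ ^ 2) (e + ‖G x‖ ^ 2) *
          (2 * (inner ℝ (F x) F2 + inner ℝ (F1 x) (F1 x)))
        + ((BAB r κ (e + ‖F x‖ ^ 2) (e + ‖G x‖ ^ 2) * (2 * inner ℝ (F x) (F1 x))
        + BBB r κ K (e + ‖F x‖ ^ 2) (e + ‖G x‖ ^ 2) * (2 * inner ℝ (G x) (G1 x)))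
          * (2 * inner ℝ (G x) (G1 x))
        + BB r κ K (e + ‖F x‖ ^ 2) (e + ‖G x‖ ^ 2) *
          (2 * (inner ℝ (G x) G2 + inner ℝ (G1 x) (G1 x))))) x v := by
  unfold HasLineDerivAt at *
  have h1 := (hF.norm_sq).const_add e
  have h2 := (hG.norm_sq).const_add e
  have hA := BA_deriv (r := r) (κ := κ) h1 h2 (by positivity) (by positivity)
  have hB := BB_deriv (r := r) (κ := κ) (K := K) h1 h2 (by positivity) (by positivity)
  have hi := (hF.inner ℝ hF1).const_mul 2
  have hi' := (hG.inner ℝ hG1).const_mul 2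
  have := (hA.mul hi).add (hB.mul hi')
  simp only [zero_smul, add_zero] at this
  exact this

lemma int_line_zero {h h' : EE n → ℝ} {v : EE n} (hh : Integrable h) (hh' : Integrable h')
    (hd : ∀ x, HasLineDerivAt ℝ h (h' x) x v) : ∫ x, h' x = 0 := by
  have := integral_bilinear_hasLineDerivAt_right_eq_neg_left_of_integrable
    (μ := (volume : Measure (EE n))) (B := ContinuousLinearMap.mul ℝ ℝ)
    (f := fun _ => (1 : ℝ)) (f' := fun _ => 0) (g := h) (g' := h') (v := v)
    (by simp) (by simpa using hh') (by simpa using hh)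
    (fun x _ => by simpa [HasLineDerivAt] using hasDerivAt_const (0 : ℝ) (1 : ℝ)) (fun x _ => hd x)
  simpa using this
end embed


section embed2
variable {n : ℕ} {H : Type*} [NormedAddCommGroup H] [InnerProductSpace ℝ H]

/-- transport part -/
noncomputable def HT (r κ K e : ℝ) (F G F2 G2 : H) : ℝ :=
  BA r κ (e + ‖F‖ ^ 2) (e + ‖G‖ ^ 2) * (2 * inner ℝ F F2)
    + BB r κ K (e + ‖F‖ ^ 2) (e + ‖G‖ ^ 2) * (2 * inner ℝ G G2)

/-- quadratic part -/
noncomputable def QJ (r κ K e : ℝ) (F G F1 G1 : H) : ℝ :=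
  BAA r κ (e + ‖F‖ ^ 2) (e + ‖G‖ ^ 2) * (2 * inner ℝ F F1) ^ 2
    + 2 * BAB r κ (e + ‖F‖ ^ 2) (e + ‖G‖ ^ 2) * ((2 * inner ℝ F F1) * (2 * inner ℝ G G1))
    + BBB r κ K (e + ‖F‖ ^ 2) (e + ‖G‖ ^ 2) * (2 * inner ℝ G G1) ^ 2
    + 2 * BA r κ (e + ‖F‖ ^ 2) (e + ‖G‖ ^ 2) * ‖F1‖ ^ 2
    + 2 * BB r κ K (e + ‖F‖ ^ 2) (e + ‖G‖ ^ 2) * ‖G1‖ ^ 2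

lemma QJ_lower {r κ K e : ℝ} (hr : 1 ≤ r) (hκ : κ = (1 - 1 / r) / 2)
    (hK : K = r * (4 * r ^ 2 + 2)) (he : 0 < e) (F G F1 G1 : H) :
    ((e + ‖F‖ ^ 2) ^ r + (e + ‖G‖ ^ 2)) ^ κ * ‖F1‖ ^ 2 + (e + ‖G‖ ^ 2) ^ (-κ) * ‖G1‖ ^ 2
      ≤ QJ r κ K e F G F1 G1 := by
  have key : ∀ u v : H, |2 * inner ℝ u v| ≤ 2 * √(e + ‖u‖ ^ 2) * ‖v‖ := by
    intro u v
    rw [abs_mul, abs_two]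
    have h1 : ‖u‖ ≤ √(e + ‖u‖ ^ 2) := Real.le_sqrt_of_sq_le (by linarith)
    have h2 := abs_real_inner_le_norm u v
    have h3 : ‖u‖ * ‖v‖ ≤ √(e + ‖u‖ ^ 2) * ‖v‖ := by gcongr
    linarith
  exact BF_quad hr hκ hK (by positivity) (by positivity) (norm_nonneg _) (norm_nonneg _)
    (key _ _) (key _ _)

lemma HT_ST {r κ K e : ℝ} (he : 0 < e) {f g f2 g2 : EE n → H} (hf : CC f) (hg : CC g)
    (hf2 : CC f2) (hg2 : CC g2) (S : ℝ) :
    Integrable (fun p : ℝ × EE n => HT r κ K e (heat p.1 f p.2) (heat p.1 g p.2)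
      (heat p.1 f2 p.2) (heat p.1 g2 p.2)) ((volume.restrict (Set.uIoc 0 S)).prod volume) := by
  have hF := BC.heat hf
  have hG := BC.heat hg
  have hA := BC.comp (BA_cont (r := r) (κ := κ)) hF hG he
  have hB := BC.comp (BB_cont (r := r) (κ := κ) (K := K)) hF hG he
  have h1 := term_ST (hA.mul (BC.const 2)) hF hf2 S
  have h2 := term_ST (hB.mul (BC.const 2)) hG hg2 S
  refine (h1.add h2).congr (Filter.Eventually.of_forall fun p => ?_)
  simp only [Pi.add_apply, HT]; ring

lemma HT_int {r κ K e : ℝ} (he : 0 < e) {f g f2 g2 : EE n → H} (hf : CC f) (hg : CC g)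
    (hf2 : CC f2) (hg2 : CC g2) (s : ℝ) :
    Integrable (fun x => HT r κ K e (heat s f x) (heat s g x) (heat s f2 x) (heat s g2 x)) := by
  have hF := BC.heat hf
  have hG := BC.heat hg
  have hA := BC.comp (BA_cont (r := r) (κ := κ)) hF hG he
  have hB := BC.comp (BB_cont (r := r) (κ := κ) (K := K)) hF hG he
  have h1 := term_int (hA.mul (BC.const 2)) hF hf2 s
  have h2 := term_int (hB.mul (BC.const 2)) hG hg2 s
  refine (h1.add h2).congr (Filter.Eventually.of_forall fun p => ?_)
  simp only [Pi.add_apply, HT]; ring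

lemma QJ_int {r κ K e : ℝ} (he : 0 < e) {f g f1 g1 : EE n → H} (hf : CC f) (hg : CC g)
    (hf1 : CC f1) (hg1 : CC g1) (s : ℝ) :
    Integrable (fun x => QJ r κ K e (heat s f x) (heat s g x) (heat s f1 x) (heat s g1 x)) := by
  have hF := BC.heat hf
  have hG := BC.heat hg
  have hF1 := BC.heat hf1
  have hG1 := BC.heat hg1
  have hA := BC.comp (BA_cont (r := r) (κ := κ)) hF hG he
  have hB := BC.comp (BB_cont (r := r) (κ := κ) (K := K)) hF hG he
  have hAA := BC.comp (BAA_cont (r := r) (κ := κ)) hF hG he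
  have hAB := BC.comp (BAB_cont (r := r) (κ := κ)) hF hG he
  have hBB := BC.comp (BBB_cont (r := r) (κ := κ) (K := K)) hF hG he
  have h1 := term_int ((hAA.mul (BC.const 4)).mul (hF.inner hF1)) hF hf1 s
  have h2 := term_int ((hAB.mul (BC.const 8)).mul (hF.inner hF1)) hG hg1 s
  have h3 := term_int ((hBB.mul (BC.const 4)).mul (hG.inner hG1)) hG hg1 s
  have h4 := term_int (hA.mul (BC.const 2)) hF1 hf1 s
  have h5 := term_int (hB.mul (BC.const 2)) hG1 hg1 s
  refine ((((h1.add h2).add h3).add h4).add h5).congr (Filter.Eventually.of_forall fun p => ?_)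
  simp only [Pi.add_apply, QJ, real_inner_self_eq_norm_sq]; ring

lemma HQ_zero {r κ K e : ℝ} (he : 0 < e) {f g : EE n → H} (hf : CC f) (hg : CC g) (s : ℝ)
    (j : Fin n) :
    ∫ x, HT r κ K e (heat s f x) (heat s g x) (heat s (pd j (pd j f)) x) (heat s (pd j (pd j g)) x)
      = -∫ x, QJ r κ K e (heat s f x) (heat s g x) (heat s (pd j f) x) (heat s (pd j g) x) := by
  have i1 := HT_int (r := r) (κ := κ) (K := K) he hf hg (hf.pd j) (hg.pd j) s
  have i2 := HT_int (r := r) (κ := κ) (K := K) he hf hg ((hf.pd j).pd j) ((hg.pd j).pd j) s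
  have i3 := QJ_int (r := r) (κ := κ) (K := K) he hf hg (hf.pd j) (hg.pd j) s
  have := int_line_zero (v := ee j) i1 (i2.add i3) ?_
  · rw [integral_add' i2 i3] at this
    linarith
  · intro x
    have := hj_line (r := r) (κ := κ) (K := K) he (heat_line hf s x j) (heat_line hg s x j)
      (heat_line (hf.pd j) s x j) (heat_line (hg.pd j) s x j)
    unfold HasLineDerivAt at this ⊢
    refine this.congr_deriv ?_
    simp only [Pi.add_apply, HT, QJ, real_inner_self_eq_norm_sq]
    ring

lemma h_time {r κ K e : ℝ} (he : 0 < e) {f g : EE n → H} (hf : CC f) (hg : CC g) (s : ℝ)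
    (x : EE n) :
    HasDerivAt (fun s => BF r κ K (e + ‖heat s f x‖ ^ 2) (e + ‖heat s g x‖ ^ 2))
      (s * ((1 / (2 * Real.pi)) * ∑ j, HT r κ K e (heat s f x) (heat s g x)
        (heat s (pd j (pd j f)) x) (heat s (pd j (pd j g)) x))) s := by
  have h1 := ((heat_time hf s x).norm_sq).const_add e
  have h2 := ((heat_time hg s x).norm_sq).const_add e
  refine (BF_deriv (r := r) (κ := κ) (K := K) h1 h2 (by positivity) (by positivity)).congr_deriv ?_
  simp only [HT, Finset.sum_add_distrib, inner_smul_right, inner_sum, ← Finset.mul_sum]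
  field_simp

lemma rpow_add_le' {x y t : ℝ} (hx : 0 ≤ x) (hy : 0 ≤ y) (ht : 0 ≤ t) :
    (x + y) ^ t ≤ 2 ^ t * (x ^ t + y ^ t) := by
  have hx' := Real.rpow_nonneg hx t
  have hy' := Real.rpow_nonneg hy t
  rcases le_total x y with h | h
  · calc (x + y) ^ t ≤ (2 * y) ^ t := by gcongr; linarith
      _ = 2 ^ t * y ^ t := Real.mul_rpow (by norm_num) hy
      _ ≤ _ := by gcongr; linarith
  · calc (x + y) ^ t ≤ (2 * x) ^ t := by gcongr; linarith
      _ = 2 ^ t * x ^ t := Real.mul_rpow (by norm_num) hx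
      _ ≤ _ := by gcongr; linarith

lemma CC.int_rpow {f : EE n → H} (hf : CC f) {t : ℝ} (ht : 0 < t) :
    Integrable (fun x => ‖f x‖ ^ t) := by
  refine Continuous.integrable_of_hasCompactSupport ?_ ?_
  · exact hf.cont.norm.rpow_const fun _ => Or.inr ht.le
  · exact hf.supp.comp_left (g := fun y : H => ‖y‖ ^ t) (by simp [Real.zero_rpow ht.ne'])

lemma prod_ST {u v : EE n → H} (hu : CC u) (hv : CC v) (S : ℝ) :
    Integrable (fun p : ℝ × EE n => ‖heat p.1 u p.2‖ * ‖heat p.1 v p.2‖)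
      ((volume.restrict (Set.uIoc 0 S)).prod volume) := by
  obtain ⟨M, hM0, hM⟩ := hu.bdd
  exact (heat_ST hv S).norm.bdd_mul (c := M) (heat_cont hu).norm.aestronglyMeasurable
    (Filter.Eventually.of_forall fun p => by simpa using heat_le hM _ _)

lemma prod_int {u v : EE n → H} (hu : CC u) (hv : CC v) (s : ℝ) :
    Integrable (fun x => ‖heat s u x‖ * ‖heat s v x‖) := by
  obtain ⟨M, hM0, hM⟩ := hu.bdd
  exact (heat_L1 hv s).norm.bdd_mul (c := M) (heat_L1 hu s).norm.aestronglyMeasurable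
    (Filter.Eventually.of_forall fun p => by simpa using heat_le hM _ _)

lemma time_ii {k : ℝ × EE n → ℝ} {S : ℝ}
    (hk : Integrable k ((volume.restrict (Set.uIoc 0 S)).prod volume)) :
    IntervalIntegrable (fun s => s * ∫ x, k (s, x)) volume 0 S := by
  have := (time_ST hk).integral_prod_left
  simp only [integral_const_mul] at this
  rw [intervalIntegrable_iff]
  exact this

/-- initial-data bound -/
lemma init_bound {r κ K e : ℝ} (hr : 1 ≤ r) (hκ : κ = (1 - 1 / r) / 2) (hK : 0 ≤ K) (he : 0 < e)
    (F G : H) : BF r κ K (e + ‖F‖ ^ 2) (e + ‖G‖ ^ 2) ≤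
      (2 + K) * 2 ^ r * 2 * (e ^ ((r + 1) / 2) + e ^ (1 - κ) + ‖F‖ ^ (r + 1) + ‖G‖ ^ (1 + 1 / r)) := by
  have hr0 : 0 < r := by linarith
  have hi : 1 / r ≤ 1 := by rw [div_le_one hr0]; exact hr
  have hi0 : 0 < 1 / r := by positivity
  have hκ0 : 0 ≤ κ := by rw [hκ]; linarith
  have hκ1 : κ ≤ 1 := by rw [hκ]; linarith
  refine (BF_growth hr hκ hK (by positivity) (by positivity)).trans ?_
  have h1 := rpow_add_le' he.le (sq_nonneg ‖F‖) (t := (r + 1) / 2) (by linarith)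
  have h2 := rpow_add_le' he.le (sq_nonneg ‖G‖) (t := 1 - κ) (by linarith)
  have e1 : (‖F‖ ^ 2) ^ ((r + 1) / 2) = ‖F‖ ^ (r + 1) := by
    rw [← Real.rpow_natCast, ← Real.rpow_mul (norm_nonneg _)]; congr 1; push_cast; ring
  have e2 : (‖G‖ ^ 2) ^ (1 - κ) = ‖G‖ ^ (1 + 1 / r) := by
    rw [← Real.rpow_natCast, ← Real.rpow_mul (norm_nonneg _)]; congr 1; rw [hκ]; push_cast; ring
  rw [e1] at h1
  rw [e2] at h2
  have p1 : (2 : ℝ) ^ ((r + 1) / 2) ≤ 2 ^ r * 2 := by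
    rw [← Real.rpow_add_one (by norm_num)]
    exact Real.rpow_le_rpow_of_exponent_le (by norm_num) (by linarith)
  have p2 : (2 : ℝ) ^ (1 - κ) ≤ 2 ^ r * 2 := by
    rw [← Real.rpow_add_one (by norm_num)]
    exact Real.rpow_le_rpow_of_exponent_le (by norm_num) (by linarith)
  have n1 := Real.rpow_nonneg he.le ((r + 1) / 2)
  have n2 := Real.rpow_nonneg he.le (1 - κ)
  have n3 := Real.rpow_nonneg (norm_nonneg F) (r + 1)
  have n4 := Real.rpow_nonneg (norm_nonneg G) (1 + 1 / r)
  have h1' := h1.trans (mul_le_mul_of_nonneg_right p1 (by positivity))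
  have h2' := h2.trans (mul_le_mul_of_nonneg_right p2 (by positivity))
  calc _ ≤ (2 + K) * (2 ^ r * 2 * (e ^ ((r + 1) / 2) + ‖F‖ ^ (r + 1))
        + 2 ^ r * 2 * (e ^ (1 - κ) + ‖G‖ ^ (1 + 1 / r))) := by gcongr
    _ = _ := by ring

lemma embed_e [CompleteSpace H] {r κ K e : ℝ} (hr : 1 ≤ r) (hκ : κ = (1 - 1 / r) / 2)
    (hK : K = r * (4 * r ^ 2 + 2)) (he : 0 < e) {f g : EE n → H} (hf : CC f) (hg : CC g)
    (i j : Fin n) {S : ℝ} (hS : 0 ≤ S) :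
    (1 / Real.pi) * ∫ s in (0 : ℝ)..S, s * ∫ x, ‖heat s (pd j f) x‖ * ‖heat s (pd i g) x‖ ≤
      (2 + K) * 2 ^ r * 2 * ((e ^ ((r + 1) / 2) + e ^ (1 - κ)) *
        (volume (tsupport f ∪ tsupport g)).toReal +
        ((∫ x, ‖f x‖ ^ (r + 1)) + ∫ x, ‖g x‖ ^ (1 + 1 / r))) := by
  have hr0 : 0 < r := by linarith
  have hi : 1 / r ≤ 1 := by rw [div_le_one hr0]; exact hr
  have hi0 : 0 < 1 / r := by positivity
  have hκ0 : 0 ≤ κ := by rw [hκ]; linarith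
  have hκ1 : κ ≤ 1 := by rw [hκ]; linarith
  have hK0 : 0 ≤ K := by rw [hK]; positivity
  have hpi := Real.pi_pos
  set k : ℝ × EE n → ℝ := fun p => (1 / (2 * Real.pi)) * ∑ l, HT r κ K e (heat p.1 f p.2)
    (heat p.1 g p.2) (heat p.1 (pd l (pd l f)) p.2) (heat p.1 (pd l (pd l g)) p.2) with hk
  have kST : Integrable k ((volume.restrict (Set.uIoc 0 S)).prod volume) :=
    (integrable_finsetSum _ fun l _ =>
      HT_ST he hf hg ((hf.pd l).pd l) ((hg.pd l).pd l) S).const_mul _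
  have kint : ∀ s, ∫ x, k (s, x) = -(1 / (2 * Real.pi)) * ∫ x, ∑ l,
      QJ r κ K e (heat s f x) (heat s g x) (heat s (pd l f) x) (heat s (pd l g) x) := by
    intro s
    simp only [hk]
    rw [integral_const_mul, integral_finsetSum, integral_finsetSum]
    · simp_rw [HQ_zero he hf hg s]
      rw [Finset.sum_neg_distrib]; ring
    · exact fun l _ => QJ_int he hf hg (hf.pd l) (hg.pd l) s
    · exact fun l _ => HT_int he hf hg ((hf.pd l).pd l) ((hg.pd l).pd l) s
  have Qlow : ∀ s x, 2 * (‖heat s (pd j f) x‖ * ‖heat s (pd i g) x‖) ≤ ∑ l,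
      QJ r κ K e (heat s f x) (heat s g x) (heat s (pd l f) x) (heat s (pd l g) x) := by
    intro s x
    have hs := Finset.sum_le_sum fun l (_ : l ∈ Finset.univ) =>
      QJ_lower hr hκ hK he (heat s f x) (heat s g x) (heat s (pd l f) x) (heat s (pd l g) x)
    refine le_trans ?_ hs
    rw [Finset.sum_add_distrib]
    refine (BF_prod (r := r) hκ0 (by positivity : 0 < e + ‖heat s f x‖ ^ 2)
      (by positivity : 0 < e + ‖heat s g x‖ ^ 2) _ _).trans (add_le_add ?_ ?_)
    · exact Finset.single_le_sum (f := fun l => ((e + ‖heat s f x‖ ^ 2) ^ r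
        + (e + ‖heat s g x‖ ^ 2)) ^ κ * ‖heat s (pd l f) x‖ ^ 2)
        (fun l _ => by positivity) (Finset.mem_univ j)
    · exact Finset.single_le_sum (f := fun l => (e + ‖heat s g x‖ ^ 2) ^ (-κ)
        * ‖heat s (pd l g) x‖ ^ 2) (fun l _ => by positivity) (Finset.mem_univ i)
  have kle : ∀ s, ∫ x, ‖heat s (pd j f) x‖ * ‖heat s (pd i g) x‖ ≤ -Real.pi * ∫ x, k (s, x) := by
    intro s
    have h1 := integral_mono ((prod_int (hf.pd j) (hg.pd i) s).const_mul 2)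
      (integrable_finsetSum Finset.univ fun l _ =>
        QJ_int (r := r) (κ := κ) (K := K) he hf hg (hf.pd l) (hg.pd l) s) (Qlow s)
    rw [integral_const_mul] at h1
    rw [kint]
    have : -Real.pi * (-(1 / (2 * Real.pi)) * ∫ x, ∑ l,
      QJ r κ K e (heat s f x) (heat s g x) (heat s (pd l f) x) (heat s (pd l g) x))
      = (1 / 2) * ∫ x, ∑ l,
      QJ r κ K e (heat s f x) (heat s g x) (heat s (pd l f) x) (heat s (pd l g) x) := by
      field_simp
    rw [this]
    linarith
  have hftc : ∀ x, ∫ s in (0 : ℝ)..S, s * k (s, x) =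
      BF r κ K (e + ‖heat S f x‖ ^ 2) (e + ‖heat S g x‖ ^ 2)
        - BF r κ K (e + ‖f x‖ ^ 2) (e + ‖g x‖ ^ 2) := by
    intro x
    rw [intervalIntegral.integral_eq_sub_of_hasDerivAt
      (f := fun s => BF r κ K (e + ‖heat s f x‖ ^ 2) (e + ‖heat s g x‖ ^ 2))]
    · simp only [heat_zero]
    · intro s _
      exact h_time he hf hg s x
    · refine Continuous.intervalIntegrable ?_ _ _
      have hA := (BC.comp (BA_cont (r := r) (κ := κ)) (BC.heat hf) (BC.heat hg) he).cont
      have hB := (BC.comp (BB_cont (r := r) (κ := κ) (K := K)) (BC.heat hf) (BC.heat hg) he).cont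
      have hF := heat_cont hf
      have hG := heat_cont hg
      have hF2 := fun l => heat_cont ((hf.pd l).pd l)
      have hG2 := fun l => heat_cont ((hg.pd l).pd l)
      have hkc : Continuous k := by
        simp only [hk, HT]
        fun_prop
      fun_prop
  have hswap : ∫ s in (0 : ℝ)..S, s * ∫ x, k (s, x) = ∫ x, ∫ s in (0 : ℝ)..S, s * k (s, x) := by
    rw [← intervalIntegral_integral_swap (f := fun s x => s * k (s, x)) (time_ST kST)]
    simp only [integral_const_mul]
  -- lower bound on the FTC expression
  set Kc := tsupport f ∪ tsupport g with hKc
  have hKcomp : IsCompact Kc := hf.supp.isCompact.union hg.supp.isCompact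
  set U : EE n → ℝ := fun x => (2 + K) * 2 ^ r * 2 * (Kc.indicator
    (fun _ => e ^ ((r + 1) / 2) + e ^ (1 - κ)) x + (‖f x‖ ^ (r + 1) + ‖g x‖ ^ (1 + 1 / r))) with hU
  have iI : Integrable (Kc.indicator (fun _ : EE n => e ^ ((r + 1) / 2) + e ^ (1 - κ))) := by
    rw [integrable_indicator_iff hKcomp.measurableSet]
    exact integrableOn_const hKcomp.measure_lt_top.ne
  have i1 := hf.int_rpow (t := r + 1) (by linarith)
  have i2 := hg.int_rpow (t := 1 + 1 / r) (by linarith)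
  have iU : Integrable U := (iI.add (i1.add i2)).const_mul _
  have eU : ∫ x, U x = (2 + K) * 2 ^ r * 2 * ((e ^ ((r + 1) / 2) + e ^ (1 - κ)) *
        (volume Kc).toReal + ((∫ x, ‖f x‖ ^ (r + 1)) + ∫ x, ‖g x‖ ^ (1 + 1 / r))) := by
    simp only [hU]
    rw [integral_const_mul]
    congr 1
    have h1 := integral_add iI (i1.add i2)
    have h2 := integral_add i1 i2
    simp only [Pi.add_apply] at h1 h2
    rw [h1, h2, integral_indicator hKcomp.measurableSet]
    simp [Measure.real, mul_comm]
  have hlow : ∀ x, -U x ≤ ∫ s in (0 : ℝ)..S, s * k (s, x) := by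
    intro x
    rw [hftc]
    have m1 : BF r κ K e e ≤ BF r κ K (e + ‖heat S f x‖ ^ 2) (e + ‖heat S g x‖ ^ 2) :=
      BF_mono hr hκ0 hκ1 hK0 he he (by nlinarith [sq_nonneg ‖heat S f x‖])
        (by nlinarith [sq_nonneg ‖heat S g x‖])
    by_cases hx : x ∈ Kc
    · have m2 : BF r κ K (e + ‖f x‖ ^ 2) (e + ‖g x‖ ^ 2) ≤ U x := by
        refine (init_bound hr hκ hK0 he (f x) (g x)).trans (le_of_eq ?_)
        simp only [hU, Set.indicator_of_mem hx]
        ring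
      have m0 : 0 ≤ BF r κ K e e := by
        unfold BF
        positivity
      linarith
    · have hx1 : f x = 0 := image_eq_zero_of_notMem_tsupport fun h => hx (Or.inl h)
      have hx2 : g x = 0 := image_eq_zero_of_notMem_tsupport fun h => hx (Or.inr h)
      have hr1 : r + 1 ≠ 0 := by linarith
      have hr2 : 1 + 1 / r ≠ 0 := by linarith
      have : U x = 0 := by
        simp only [hU, Set.indicator_of_notMem hx, hx1, hx2, norm_zero]
        rw [Real.zero_rpow hr1, Real.zero_rpow hr2]; ring
      rw [this, hx1, hx2]
      simpa using m1
  have iS : Integrable (fun x => ∫ s in (0 : ℝ)..S, s * k (s, x)) := by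
    have := (time_ST kST).integral_prod_right
    simp only [intervalIntegral.integral_of_le hS]
    rw [Set.uIoc_of_le hS] at this
    exact this
  have hfin := integral_mono iU.neg iS hlow
  rw [← hswap, integral_neg', eU] at hfin
  have hmain : ∫ s in (0 : ℝ)..S, s * ∫ x, ‖heat s (pd j f) x‖ * ‖heat s (pd i g) x‖
      ≤ ∫ s in (0 : ℝ)..S, -Real.pi * (s * ∫ x, k (s, x)) := by
    refine intervalIntegral.integral_mono_on hS (time_ii (prod_ST (hf.pd j) (hg.pd i) S))
      ((time_ii kST).const_mul _) ?_
    intro s hs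
    have := mul_le_mul_of_nonneg_left (kle s) hs.1
    linarith
  rw [intervalIntegral.integral_const_mul] at hmain
  calc _ ≤ (1 / Real.pi) * (-Real.pi * ∫ s in (0 : ℝ)..S, s * ∫ x, k (s, x)) := by gcongr
    _ = -∫ s in (0 : ℝ)..S, s * ∫ x, k (s, x) := by field_simp
    _ ≤ _ := by linarith

/-- the bilinear embedding theorem -/
theorem embed [CompleteSpace H] {r : ℝ} (hr : 1 ≤ r) {f g : EE n → H} (hf : CC f) (hg : CC g)
    (i j : Fin n) {S : ℝ} (hS : 0 ≤ S) :
    (1 / Real.pi) * ∫ s in (0 : ℝ)..S, s * ∫ x, ‖heat s (pd j f) x‖ * ‖heat s (pd i g) x‖ ≤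
      (2 + r * (4 * r ^ 2 + 2)) * 2 ^ r * 2 *
        ((∫ x, ‖f x‖ ^ (r + 1)) + ∫ x, ‖g x‖ ^ (1 + 1 / r)) := by
  have hr0 : 0 < r := by linarith
  have hi0 : 0 < 1 / r := by positivity
  have hlim : Filter.Tendsto (fun e : ℝ => (2 + r * (4 * r ^ 2 + 2)) * 2 ^ r * 2 *
      ((e ^ ((r + 1) / 2) + e ^ (1 - (1 - 1 / r) / 2)) *
        (volume (tsupport f ∪ tsupport g)).toReal +
        ((∫ x, ‖f x‖ ^ (r + 1)) + ∫ x, ‖g x‖ ^ (1 + 1 / r)))) (nhdsWithin 0 (Set.Ioi 0))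
      (nhds ((2 + r * (4 * r ^ 2 + 2)) * 2 ^ r * 2 * ((0 ^ ((r + 1) / 2)
        + 0 ^ (1 - (1 - 1 / r) / 2)) * (volume (tsupport f ∪ tsupport g)).toReal +
        ((∫ x, ‖f x‖ ^ (r + 1)) + ∫ x, ‖g x‖ ^ (1 + 1 / r))))) := by
    have c1 : Continuous fun e : ℝ => e ^ ((r + 1) / 2) :=
      Real.continuous_rpow_const (by linarith)
    have c2 : Continuous fun e : ℝ => e ^ (1 - (1 - 1 / r) / 2) :=
      Real.continuous_rpow_const (by linarith)
    refine (Continuous.tendsto ?_ 0).mono_left nhdsWithin_le_nhds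
    fun_prop
  rw [Real.zero_rpow (by linarith), Real.zero_rpow (by linarith), add_zero, zero_mul, zero_add]
    at hlim
  refine ge_of_tendsto hlim ?_
  filter_upwards [self_mem_nhdsWithin] with e he
  exact embed_e hr rfl rfl he hf hg i j hS
end embed2


section duality
variable {n : ℕ} {H : Type*} [NormedAddCommGroup H] [InnerProductSpace ℝ H]

lemma ip_int {u v : EE n → H} (hu : CC u) (hv : CC v) (s : ℝ) :
    Integrable (fun x => inner ℝ (heat s u x) (heat s v x)) := by
  have := term_int (BC.const 1) (BC.heat hu) hv s
  simpa using this

lemma ip_ST {u v : EE n → H} (hu : CC u) (hv : CC v) (S : ℝ) :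
    Integrable (fun p : ℝ × EE n => (inner ℝ (heat p.1 u p.2) (heat p.1 v p.2) : ℝ))
      ((volume.restrict (Set.uIoc 0 S)).prod volume) := by
  have := term_ST (BC.const 1) (BC.heat hu) hv S
  simpa using this

lemma ip_parts {u v : EE n → H} (hu : CC u) (hv : CC v) (s : ℝ) (i : Fin n) :
    ∫ x, (inner ℝ (heat s (pd i u) x) (heat s v x) : ℝ)
      = -∫ x, (inner ℝ (heat s u x) (heat s (pd i v) x) : ℝ) := by
  have h := int_line_zero (v := ee i) (ip_int hu hv s)
    ((ip_int hu (hv.pd i) s).add (ip_int (hu.pd i) hv s)) (fun x => by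
      have h1 := heat_line hu s x i
      have h2 := heat_line hv s x i
      unfold HasLineDerivAt at *
      have := h1.inner ℝ h2
      simpa using this)
  have h' := integral_add (ip_int hu (hv.pd i) s) (ip_int (hu.pd i) hv s)
  simp only [Pi.add_apply] at h
  linarith

lemma ip_le {u v : EE n → H} (hu : CC u) (hv : CC v) {S : ℝ} (hS : 0 < S) :
    ∫ x, (inner ℝ (heat S u x) (heat S v x) : ℝ)
      ≤ (S ^ n)⁻¹ * (∫ x, ‖u x‖) * ∫ x, ‖v x‖ := by
  have h0 : 0 ≤ (S ^ n)⁻¹ * ∫ x, ‖u x‖ :=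
    mul_nonneg (by positivity) (integral_nonneg fun _ => norm_nonneg _)
  calc ∫ x, (inner ℝ (heat S u x) (heat S v x) : ℝ)
      ≤ ∫ x, ((S ^ n)⁻¹ * ∫ x, ‖u x‖) * ‖heat S v x‖ := by
        refine integral_mono (ip_int hu hv S) ((heat_L1 hv S).norm.const_mul _) fun x => ?_
        exact (real_inner_le_norm _ _).trans
          (mul_le_mul_of_nonneg_right (heat_decay hu hS x) (norm_nonneg _))
    _ = ((S ^ n)⁻¹ * ∫ x, ‖u x‖) * ∫ x, ‖heat S v x‖ := integral_const_mul _ _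
    _ ≤ _ := mul_le_mul_of_nonneg_left (heat_L1_le hv S) h0

lemma heat_sum {ι : Type*} (t : Finset ι) {u : ι → EE n → H} (hu : ∀ l, CC (u l)) (s : ℝ) (x : EE n) :
    ∑ l ∈ t, heat s (u l) x = heat s (fun y => ∑ l ∈ t, u l y) x := by
  unfold heat
  rw [← integral_finsetSum _ (fun l _ => heat_int (hu l) s x)]
  simp only [Finset.smul_sum]

lemma dual_S [CompleteSpace H] {w f g : EE n → H} {h : Fin n → EE n → H} (hw : CC w) (hf : CC f)
    (hg : CC g) (hh : ∀ l, CC (h l)) (i : Fin n)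
    (hb : ∀ l s x, ‖heat s (h l) x‖ ≤ ‖heat s (pd l f) x‖)
    (hΔ : ∀ x, ∑ j, pd j (pd j w) x = -∑ l, pd i (h l) x) {S : ℝ} (hS : 0 < S) :
    ∫ x, (inner ℝ (w x) (g x) : ℝ) ≤ (S ^ n)⁻¹ * (∫ x, ‖w x‖) * (∫ x, ‖g x‖) +
      ∑ l, (1 / Real.pi) * ∫ s in (0 : ℝ)..S, s * ∫ x, ‖heat s (pd l f) x‖ * ‖heat s (pd i g) x‖ := by
  have hpi := Real.pi_pos
  set k : ℝ × EE n → ℝ := fun p => (1 / (2 * Real.pi)) * ∑ l,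
    (inner ℝ (heat p.1 (pd l (pd l w)) p.2) (heat p.1 g p.2)
      + inner ℝ (heat p.1 w p.2) (heat p.1 (pd l (pd l g)) p.2)) with hk
  have kST : Integrable k ((volume.restrict (Set.uIoc 0 S)).prod volume) :=
    (integrable_finsetSum _ fun l _ =>
      (ip_ST ((hw.pd l).pd l) hg S).add (ip_ST hw ((hg.pd l).pd l) S)).const_mul _
  have hΔh : ∀ s x, ∑ j, heat s (pd j (pd j w)) x = -∑ l, heat s (pd i (h l)) x := by
    intro s x
    rw [heat_sum _ (fun j => (hw.pd j).pd j), heat_sum _ (fun l => (hh l).pd i)]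
    unfold heat
    rw [← integral_neg]
    simp only [hΔ, smul_neg]
  have kint : ∀ s, ∫ x, k (s, x) = (1 / Real.pi) *
      ∑ l, ∫ x, (inner ℝ (heat s (h l) x) (heat s (pd i g) x) : ℝ) := by
    intro s
    simp only [hk]
    rw [integral_const_mul, integral_finsetSum]
    · have e1 : ∀ l, ∫ x, ((inner ℝ (heat s (pd l (pd l w)) x) (heat s g x) : ℝ)
          + inner ℝ (heat s w x) (heat s (pd l (pd l g)) x))
          = 2 * ∫ x, (inner ℝ (heat s (pd l (pd l w)) x) (heat s g x) : ℝ) := by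
        intro l
        have a1 := ip_parts (hw.pd l) hg s l
        have a2 := ip_parts hw (hg.pd l) s l
        rw [integral_add (ip_int ((hw.pd l).pd l) hg s) (ip_int hw ((hg.pd l).pd l) s)]
        linarith
      simp_rw [e1]
      rw [← Finset.mul_sum, ← integral_finsetSum _ (fun l _ => ip_int ((hw.pd l).pd l) hg s)]
      simp_rw [← sum_inner, hΔh, inner_neg_left, sum_inner]
      rw [integral_neg, integral_finsetSum _ (fun l _ => ip_int ((hh l).pd i) hg s)]
      simp_rw [ip_parts (hh _) hg s i]
      rw [Finset.sum_neg_distrib]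
      field_simp
    · exact fun l _ => (ip_int ((hw.pd l).pd l) hg s).add (ip_int hw ((hg.pd l).pd l) s)
  have kle : ∀ s, -∫ x, k (s, x) ≤ (1 / Real.pi) *
      ∑ l, ∫ x, ‖heat s (pd l f) x‖ * ‖heat s (pd i g) x‖ := by
    intro s
    rw [kint, ← mul_neg, ← Finset.sum_neg_distrib]
    refine mul_le_mul_of_nonneg_left (Finset.sum_le_sum fun l _ => ?_) (by positivity)
    rw [← integral_neg]
    refine integral_mono (ip_int (hh l) (hg.pd i) s).neg (prod_int (hf.pd l) (hg.pd i) s) fun x => ?_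
    have h1 := abs_real_inner_le_norm (heat s (h l) x) (heat s (pd i g) x)
    have h2 := mul_le_mul_of_nonneg_right (hb l s x) (norm_nonneg (heat s (pd i g) x))
    have h3 := neg_abs_le (inner ℝ (heat s (h l) x) (heat s (pd i g) x) : ℝ)
    show -(inner ℝ (heat s (h l) x) (heat s (pd i g) x) : ℝ) ≤ _
    linarith
  have hftc : ∀ x, ∫ s in (0 : ℝ)..S, s * k (s, x) =
      inner ℝ (heat S w x) (heat S g x) - inner ℝ (w x) (g x) := by
    intro x
    rw [intervalIntegral.integral_eq_sub_of_hasDerivAt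
      (f := fun s => (inner ℝ (heat s w x) (heat s g x) : ℝ))]
    · simp only [heat_zero]
    · intro s _
      have := (heat_time hw s x).inner ℝ (heat_time hg s x)
      refine HasDerivAt.congr_deriv this ?_
      simp only [hk, real_inner_smul_left, real_inner_smul_right, sum_inner, inner_sum, Finset.sum_add_distrib]
      ring
    · refine Continuous.intervalIntegrable ?_ _ _
      have hF := heat_cont hw
      have hG := heat_cont hg
      have hF2 := fun l => heat_cont ((hw.pd l).pd l)
      have hG2 := fun l => heat_cont ((hg.pd l).pd l)
      have hkc : Continuous k := by
        simp only [hk]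
        fun_prop
      fun_prop
  have hswap : ∫ s in (0 : ℝ)..S, s * ∫ x, k (s, x) = ∫ x, ∫ s in (0 : ℝ)..S, s * k (s, x) := by
    rw [← intervalIntegral_integral_swap (f := fun s x => s * k (s, x)) (time_ST kST)]
    simp only [integral_const_mul]
  have i0 : Integrable (fun x => (inner ℝ (w x) (g x) : ℝ)) := by
    have := ip_int hw hg 0
    simpa only [heat_zero] using this
  simp only [hftc] at hswap
  rw [integral_sub (ip_int hw hg S) i0] at hswap
  have hmain : ∫ s in (0 : ℝ)..S, -1 * (s * ∫ x, k (s, x)) ≤ ∫ s in (0 : ℝ)..S, ∑ l,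
      (1 / Real.pi) * (s * ∫ x, ‖heat s (pd l f) x‖ * ‖heat s (pd i g) x‖) := by
    refine intervalIntegral.integral_mono_on hS.le ((time_ii kST).const_mul _) ?_ ?_
    · have := IntervalIntegrable.sum Finset.univ fun l (_ : l ∈ Finset.univ) =>
        (time_ii (prod_ST (hf.pd l) (hg.pd i) S)).const_mul (1 / Real.pi)
      rw [Finset.sum_fn] at this
      exact this
    intro s hs
    have := mul_le_mul_of_nonneg_left (kle s) hs.1
    rw [Finset.mul_sum, Finset.mul_sum] at this
    calc _ = s * -∫ x, k (s, x) := by ring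
      _ ≤ _ := this
      _ = _ := Finset.sum_congr rfl fun l _ => by ring
  rw [intervalIntegral.integral_const_mul, intervalIntegral.integral_finsetSum (fun l _ =>
    (time_ii (prod_ST (hf.pd l) (hg.pd i) S)).const_mul (1 / Real.pi))] at hmain
  simp only [intervalIntegral.integral_const_mul] at hmain
  have := ip_le hw hg hS
  linarith
end duality


section concl
variable {n : ℕ} {H : Type*} [NormedAddCommGroup H] [InnerProductSpace ℝ H]

/-- embedding constant -/
noncomputable def KR (r : ℝ) : ℝ := (2 + r * (4 * r ^ 2 + 2)) * 2 ^ r * 2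

lemma KR_pos {r : ℝ} (hr : 0 < r) : 0 < KR r := by unfold KR; positivity

lemma dual_lim [CompleteSpace H] (hn : 0 < n) {w f g : EE n → H} {h : Fin n → EE n → H}
    (hw : CC w) (hf : CC f)
    (hg : CC g) (hh : ∀ l, CC (h l)) (i : Fin n)
    (hb : ∀ l s x, ‖heat s (h l) x‖ ≤ ‖heat s (pd l f) x‖)
    (hΔ : ∀ x, ∑ j, pd j (pd j w) x = -∑ l, pd i (h l) x) {B : ℝ}
    (hB : ∀ l : Fin n, ∀ S : ℝ, 0 < S → (1 / Real.pi) * ∫ s in (0 : ℝ)..S, s *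
      ∫ x, ‖heat s (pd l f) x‖ * ‖heat s (pd i g) x‖ ≤ B) :
    ∫ x, (inner ℝ (w x) (g x) : ℝ) ≤ n * B := by
  have hlim : Filter.Tendsto (fun S : ℝ => (S ^ n)⁻¹ * (∫ x, ‖w x‖) * (∫ x, ‖g x‖) + n * B)
      Filter.atTop (nhds (0 * (∫ x, ‖w x‖) * (∫ x, ‖g x‖) + n * B)) := by
    have : Filter.Tendsto (fun S : ℝ => (S ^ n)⁻¹) Filter.atTop (nhds 0) :=
      (Filter.tendsto_pow_atTop hn.ne').inv_tendsto_atTop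
    exact ((this.mul_const _).mul_const _).add_const _
  rw [zero_mul, zero_mul, zero_add] at hlim
  refine ge_of_tendsto hlim ?_
  filter_upwards [Filter.eventually_gt_atTop 0] with S hS
  refine (dual_S hw hf hg hh i hb hΔ hS).trans ?_
  gcongr
  refine (Finset.sum_le_sum fun l _ => hB l S hS).trans ?_
  simp

/-- constant in the duality estimate -/
noncomputable def KQ (n : ℕ) (q : ℝ) : ℝ := n * (KR (q - 1) + KR (1 / (q - 1)))

lemma dual_q [CompleteSpace H] (hn : 0 < n) {q : ℝ} (hq : 1 < q) {w f g : EE n → H}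
    {h : Fin n → EE n → H} (hw : CC w) (hf : CC f)
    (hg : CC g) (hh : ∀ l, CC (h l)) (i : Fin n)
    (hb : ∀ l s x, ‖heat s (h l) x‖ ≤ ‖heat s (pd l f) x‖)
    (hΔ : ∀ x, ∑ j, pd j (pd j w) x = -∑ l, pd i (h l) x) :
    ∫ x, (inner ℝ (w x) (g x) : ℝ) ≤ KQ n q *
      ((∫ x, ‖f x‖ ^ q) + ∫ x, ‖g x‖ ^ (q / (q - 1))) := by
  have hq1 : 0 < q - 1 := by linarith
  have k1 := KR_pos hq1
  have k2 := KR_pos (one_div_pos.2 hq1)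
  have i1 : 0 ≤ ∫ x, ‖f x‖ ^ q := integral_nonneg fun _ => by positivity
  have i2 : 0 ≤ ∫ x, ‖g x‖ ^ (q / (q - 1)) := integral_nonneg fun _ => by positivity
  unfold KQ
  rw [mul_assoc]
  refine dual_lim hn hw hf hg hh i hb hΔ fun l S hS => ?_
  rcases le_total 2 q with h2 | h2
  · have := embed (r := q - 1) (by linarith) hf hg i l hS.le
    rw [show q - 1 + 1 = q by ring, show 1 + 1 / (q - 1) = q / (q - 1) by field_simp; ring] at this
    refine this.trans (mul_le_mul_of_nonneg_right ?_ (add_nonneg i1 i2))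
    show KR (q - 1) ≤ _
    linarith
  · have := embed (r := 1 / (q - 1)) (by rw [le_div_iff₀ hq1]; linarith) hg hf l i hS.le
    rw [show 1 / (q - 1) + 1 = q / (q - 1) by field_simp; ring,
      show 1 + 1 / (1 / (q - 1)) = q by field_simp; ring] at this
    simp only [mul_comm ‖heat _ (pd i g) _‖] at this
    refine this.trans ?_
    rw [add_comm (∫ x, ‖g x‖ ^ (q / (q - 1)))]
    refine (mul_le_mul_of_nonneg_right ?_ (add_nonneg i1 i2))
    show KR (1 / (q - 1)) ≤ _
    linarith

lemma lim_int {q : ℝ} (hq : 1 < q) {w : EE n → H} (hw : CC w) (Φ : ℝ → ℝ → ℝ)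
    (h0 : ∀ e, 0 < e → Φ e 0 = 0) (hc : ∀ e, 0 < e → Continuous (Φ e))
    (hbd : ∀ e, 0 < e → ∀ a, 0 ≤ a → |Φ e a| ≤ (e + a ^ 2) ^ (q / 2))
    (hl : ∀ a, 0 < a → Filter.Tendsto (fun e => Φ e a) (nhdsWithin 0 (Set.Ioi 0)) (nhds (a ^ q))) :
    Filter.Tendsto (fun e => ∫ x, Φ e ‖w x‖) (nhdsWithin 0 (Set.Ioi 0))
      (nhds (∫ x, ‖w x‖ ^ q)) := by
  obtain ⟨M, hM0, hM⟩ := hw.bdd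
  have hK := hw.supp.isCompact
  refine tendsto_integral_filter_of_dominated_convergence
    ((tsupport w).indicator fun _ => (1 + M ^ 2) ^ (q / 2)) ?_ ?_ ?_ ?_
  · filter_upwards [self_mem_nhdsWithin] with e he
    exact ((hc e he).comp hw.cont.norm).aestronglyMeasurable
  · have : Set.Ioo (0 : ℝ) 1 ∈ nhdsWithin (0 : ℝ) (Set.Ioi 0) := Ioo_mem_nhdsGT one_pos
    filter_upwards [this] with e he
    refine Filter.Eventually.of_forall fun x => ?_
    by_cases hx : x ∈ tsupport w
    · rw [Set.indicator_of_mem hx, Real.norm_eq_abs]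
      refine (hbd e he.1 _ (norm_nonneg _)).trans ?_
      have := he.1
      have := he.2
      have := hM x
      gcongr
    · rw [Set.indicator_of_notMem hx, image_eq_zero_of_notMem_tsupport hx, norm_zero, h0 e he.1]
      simp
  · rw [integrable_indicator_iff hK.measurableSet]
    exact integrableOn_const hK.measure_lt_top.ne
  · refine Filter.Eventually.of_forall fun x => ?_
    rcases (norm_nonneg (w x)).eq_or_lt with h | h
    · rw [← h, Real.zero_rpow (by linarith)]
      refine tendsto_const_nhds.congr' ?_
      filter_upwards [self_mem_nhdsWithin] with e he
      exact (h0 e he).symm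
    · exact hl _ h

lemma apriori [CompleteSpace H] (hn : 0 < n) {q : ℝ} (hq : 1 < q) {w f : EE n → H}
    {h : Fin n → EE n → H} (hw : CC w) (hf : CC f) (hh : ∀ l, CC (h l)) (i : Fin n)
    (hb : ∀ l s x, ‖heat s (h l) x‖ ≤ ‖heat s (pd l f) x‖)
    (hΔ : ∀ x, ∑ j, pd j (pd j w) x = -∑ l, pd i (h l) x) {τ : ℝ} (hτ : 0 < τ) :
    τ * ∫ x, ‖w x‖ ^ q ≤ KQ n q *
      ((∫ x, ‖f x‖ ^ q) + τ ^ (q / (q - 1)) * ∫ x, ‖w x‖ ^ q) := by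
  have hq1 : 0 < q - 1 := by linarith
  have l1 := lim_int hq hw (fun e a => (e + a ^ 2) ^ ((q - 2) / 2) * a ^ 2)
    (fun e he => by simp)
    (fun e he => by
      refine Continuous.mul (Continuous.rpow_const (by fun_prop) fun a => Or.inl ?_) (by fun_prop)
      positivity)
    (fun e he a ha => by
      rw [abs_of_nonneg (by positivity)]
      have hp : 0 < e + a ^ 2 := by positivity
      calc (e + a ^ 2) ^ ((q - 2) / 2) * a ^ 2 ≤ (e + a ^ 2) ^ ((q - 2) / 2) * (e + a ^ 2) := by
            gcongr; linarith
        _ = _ := by rw [← Real.rpow_add_one hp.ne']; congr 1; ring)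
    (fun a ha => by
      have : Filter.Tendsto (fun e : ℝ => (e + a ^ 2) ^ ((q - 2) / 2) * a ^ 2)
          (nhds 0) (nhds ((0 + a ^ 2) ^ ((q - 2) / 2) * a ^ 2)) := by
        have c1 : ContinuousAt (fun e : ℝ => (e + a ^ 2) ^ ((q - 2) / 2)) 0 :=
          ContinuousAt.rpow_const (by fun_prop) (Or.inl (by positivity))
        exact c1.tendsto.mul_const _
      refine (this.mono_left nhdsWithin_le_nhds).trans (le_of_eq (congrArg nhds ?_))
      rw [zero_add, ← Real.rpow_natCast, ← Real.rpow_mul ha.le, ← Real.rpow_add ha]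
      congr 1; push_cast; ring)
  have l2 := lim_int hq hw (fun e a => ((e + a ^ 2) ^ ((q - 2) / 2) * |a|) ^ (q / (q - 1)))
    (fun e he => by simp; rw [Real.zero_rpow]; positivity)
    (fun e he => by
      refine Continuous.rpow_const (Continuous.mul
        (Continuous.rpow_const (by fun_prop) fun a => Or.inl ?_) (by fun_prop))
        fun a => Or.inr (by positivity)
      positivity)
    (fun e he a ha => by
      rw [abs_of_nonneg (by positivity), abs_of_nonneg ha]
      have hp : 0 < e + a ^ 2 := by positivity
      have h1 : a ≤ (e + a ^ 2) ^ (1 / 2 : ℝ) := by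
        rw [← Real.sqrt_eq_rpow]; exact Real.le_sqrt_of_sq_le (by linarith)
      calc ((e + a ^ 2) ^ ((q - 2) / 2) * a) ^ (q / (q - 1))
          ≤ ((e + a ^ 2) ^ ((q - 2) / 2) * (e + a ^ 2) ^ (1 / 2 : ℝ)) ^ (q / (q - 1)) := by
            gcongr
        _ = _ := by
          rw [← Real.rpow_add hp, ← Real.rpow_mul hp.le]; congr 1; field_simp; ring)
    (fun a ha => by
      have : Filter.Tendsto (fun e : ℝ => ((e + a ^ 2) ^ ((q - 2) / 2) * |a|) ^ (q / (q - 1)))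
          (nhds 0) (nhds (((0 + a ^ 2) ^ ((q - 2) / 2) * |a|) ^ (q / (q - 1)))) := by
        have c1 : ContinuousAt (fun e : ℝ => (e + a ^ 2) ^ ((q - 2) / 2)) 0 :=
          ContinuousAt.rpow_const (by fun_prop) (Or.inl (by positivity))
        exact (c1.tendsto.mul_const _).rpow_const (Or.inr (by positivity))
      refine (this.mono_left nhdsWithin_le_nhds).trans (le_of_eq (congrArg nhds ?_))
      rw [zero_add, abs_of_pos ha, ← Real.rpow_natCast, ← Real.rpow_mul ha.le,
        ← Real.rpow_add_one ha.ne', ← Real.rpow_mul ha.le]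
      congr 1; push_cast; field_simp; ring)
  have lim1 := l1.const_mul τ
  have lim2 := ((l2.const_mul (τ ^ (q / (q - 1)))).const_add (∫ x, ‖f x‖ ^ q)).const_mul (KQ n q)
  refine le_of_tendsto_of_tendsto lim1 lim2 ?_
  filter_upwards [self_mem_nhdsWithin] with e he
  have he : 0 < e := he
  have hg : CC (fun x => (τ * (e + ‖w x‖ ^ 2) ^ ((q - 2) / 2)) • w x) := by
    refine ⟨?_, hw.supp.smul_left⟩
    refine ContDiff.smul (contDiff_const.mul (ContDiff.rpow_const_of_ne
      (contDiff_const.add (hw.smooth.norm_sq ℝ)) fun x => ?_)) hw.smooth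
    positivity
  have := dual_q hn hq hw hf hg hh i hb hΔ
  rw [← integral_const_mul, ← integral_const_mul]
  refine le_trans (le_of_eq ?_) (this.trans (le_of_eq ?_))
  · congr 1; ext x
    rw [real_inner_smul_right, real_inner_self_eq_norm_sq]; ring
  · congr 3; ext x
    rw [norm_smul, Real.norm_of_nonneg (by positivity), mul_assoc, abs_of_nonneg (norm_nonneg _),
      Real.mul_rpow hτ.le (by positivity)]

lemma final_const (n : ℕ) (hn : 0 < n) (q : ℝ) (hq : 1 < q) : ∃ C : ℝ, 0 ≤ C ∧
    ∀ A F : ℝ, (∀ τ : ℝ, 0 < τ → τ * A ≤ KQ n q * (F + τ ^ (q / (q - 1)) * A)) →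
      A ≤ C * F := by
  have hq1 : 0 < q - 1 := by linarith
  have hK : 0 < KQ n q := by
    have k1 := KR_pos hq1
    have k2 := KR_pos (one_div_pos.2 hq1)
    unfold KQ
    have : (0 : ℝ) < n := by exact_mod_cast hn
    positivity
  set K := KQ n q
  set τ : ℝ := (1 / (2 * K)) ^ (q - 1) with hτ
  have hτ0 : 0 < τ := by positivity
  have hp : τ ^ (q / (q - 1)) = τ * (1 / (2 * K)) := by
    rw [show q / (q - 1) = 1 + 1 / (q - 1) by field_simp; ring, Real.rpow_add hτ0, Real.rpow_one]
    congr 1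
    rw [hτ, ← Real.rpow_mul (by positivity), mul_one_div, div_self hq1.ne', Real.rpow_one]
  refine ⟨2 * K / τ, by positivity, fun A F h => ?_⟩
  have := h τ hτ0
  rw [hp] at this
  have e : K * (F + τ * (1 / (2 * K)) * A) = K * F + τ * A / 2 := by field_simp
  rw [e] at this
  rw [div_mul_eq_mul_div, le_div_iff₀ hτ0]
  linarith
end concl


section algebra
variable {n : ℕ} {H : Type*} [NormedAddCommGroup H] [NormedSpace ℝ H]

lemma pd_clm (G : H →L[ℝ] H) {u : EE n → H} (hu : CC u) (i : Fin n) (x : EE n) :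
    pd i (fun y => G (u y)) x = G (pd i u x) := by
  unfold pd
  have := (G.hasFDerivAt.comp x (hu.diff x).hasFDerivAt).fderiv
  have h2 : (fun y => G (u y)) = G ∘ u := rfl
  rw [h2, this]; rfl

lemma pd_sum {u : Fin n → EE n → H} (hu : ∀ j, CC (u j)) (i : Fin n) (x : EE n) :
    pd i (fun y => ∑ j, u j y) x = ∑ j, pd i (u j) x := by
  unfold pd
  rw [fderiv_fun_sum (fun j _ => (hu j).diff x)]
  simp

lemma CC.clm (G : H →L[ℝ] H) {u : EE n → H} (hu : CC u) : CC (fun y => G (u y)) :=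
  ⟨G.contDiff.comp hu.smooth, hu.supp.comp_left (map_zero G)⟩

lemma CC.sum {u : Fin n → EE n → H} (hu : ∀ j, CC (u j)) : CC (fun y => ∑ j, u j y) := by
  refine ⟨ContDiff.sum fun j _ => (hu j).smooth, ?_⟩
  have : IsCompact (⋃ j, tsupport (u j)) := isCompact_iUnion fun j => (hu j).supp.isCompact
  refine HasCompactSupport.intro this fun x hx => ?_
  refine Finset.sum_eq_zero fun j _ => image_eq_zero_of_notMem_tsupport fun h => hx ?_
  exact Set.mem_iUnion.2 ⟨j, h⟩

lemma pd_comm {u : EE n → H} (hu : CC u) (i j : Fin n) : pd i (pd j u) = pd j (pd i u) := by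
  ext x
  have hs : IsSymmSndFDerivAt ℝ u x :=
    (hu.smooth.contDiffAt (x := x)).isSymmSndFDerivAt
      (by simp only [minSmoothness_of_isRCLikeNormedField]; exact WithTop.coe_le_coe.2 (le_top : (2 : ℕ∞) ≤ ⊤))
  have hd : DifferentiableAt ℝ (fderiv ℝ u) x :=
    ((hu.smooth.fderiv_right (m := (⊤ : ℕ∞)) (by simp)).differentiable (by simp)) x
  have key : ∀ a b : Fin n, pd a (pd b u) x = fderiv ℝ (fderiv ℝ u) x (ee a) (ee b) := by
    intro a b
    unfold pd
    rw [fderiv_clm_apply hd (differentiableAt_const _)]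
    simp
  rw [key, key]
  exact hs.eq _ _

lemma heat_clm [CompleteSpace H] (G : H →L[ℝ] H) {u : EE n → H} (hu : CC u) (s : ℝ) (x : EE n) :
    heat s (fun y => G (u y)) x = G (heat s u x) := by
  unfold heat
  rw [← G.integral_comp_comm (heat_int hu s x)]
  simp
end algebra

lemma cliff_norm {V : Type*} [NormedAddCommGroup V] [InnerProductSpace ℂ V] (T : V →ₗ[ℂ] V)
    (h1 : ∀ ψ, T (T ψ) + T (T ψ) = (-2 : ℂ) • ψ) (h2 : ∀ φ ψ : V, ⟪T φ, ψ⟫_ℂ = -⟪φ, T ψ⟫_ℂ)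
    (v : V) : ‖T v‖ = ‖v‖ := by
  have h3 : T (T v) = -v := by
    have := h1 v
    rw [← two_smul ℂ, neg_smul, ← smul_neg] at this
    exact smul_right_injective V (two_ne_zero (α := ℂ)) this
  have h4 := h2 v (T v)
  rw [h3, inner_neg_right, neg_neg, inner_self_eq_norm_sq_to_K, inner_self_eq_norm_sq_to_K] at h4
  have h5 : ‖T v‖ ^ 2 = ‖v‖ ^ 2 := by exact_mod_cast h4
  exact (sq_eq_sq₀ (norm_nonneg _) (norm_nonneg _)).1 h5

theorem stmt11 (n : ℕ) (hn : 3 ≤ n) (q : ℝ) (hq : 1 < q) :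
    ∃ C : ℝ, ∀ (V : Type u) [NormedAddCommGroup V] [InnerProductSpace ℂ V]
      [FiniteDimensional ℂ V] [Nontrivial V],
      ∀ γ : Fin n → V →ₗ[ℂ] V,
      (∀ i j (ψ : V), γ i (γ j ψ) + γ j (γ i ψ) =
        if i = j then (-2 : ℂ) • ψ else 0) →
      (∀ i (φ ψ : V), ⟪γ i φ, ψ⟫_ℂ = -⟪φ, γ i ψ⟫_ℂ) →
      ∀ φ : EuclideanSpace ℝ (Fin n) → V,
        ContDiff ℝ (⊤ : ℕ∞) φ → HasCompactSupport φ →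
        ∑ i, (∫ x : EuclideanSpace ℝ (Fin n),
            ‖fderiv ℝ φ x (EuclideanSpace.single i 1)‖ ^ q) ^ (1 / q) ≤
          C * (∫ x : EuclideanSpace ℝ (Fin n), ‖dirac γ φ x‖ ^ q) ^ (1 / q) := by
  obtain ⟨C, hC0, hC⟩ := final_const n (by omega) q hq
  refine ⟨n * C ^ (1 / q), ?_⟩
  intro V _ _ _ _ γ hcl hsk φ hφ hφs
  let _ : InnerProductSpace ℝ V := InnerProductSpace.rclikeToReal ℂ V
  have : CompleteSpace V := FiniteDimensional.complete ℂ V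
  have hc : CC φ := ⟨hφ, hφs⟩
  let G : Fin n → V →L[ℝ] V := fun l => (LinearMap.toContinuousLinearMap (γ l)).restrictScalars ℝ
  have hG : ∀ l v, G l v = γ l v := fun l v => rfl
  have hGn : ∀ l v, ‖G l v‖ = ‖v‖ := fun l v =>
    cliff_norm (γ l) (fun ψ => by simpa using hcl l l ψ) (hsk l) v
  have hGG : ∀ l j v, G l (G j v) + G j (G l v) = if l = j then (-2 : ℝ) • v else 0 := by
    intro l j v
    have := hcl l j v
    simp only [hG, this]
    split_ifs
    · rw [neg_smul, neg_smul, two_smul, two_smul]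
    · rfl
  have hf : CC (dirac γ φ) := CC.sum fun j => CC.clm (G j) (hc.pd j)
  have hh : ∀ l, CC (fun x => G l (pd l (dirac γ φ) x)) := fun l => CC.clm (G l) (hf.pd l)
  have main : ∀ i, (∫ x, ‖pd i φ x‖ ^ q) ≤ C * ∫ x, ‖dirac γ φ x‖ ^ q := by
    intro i
    refine hC _ _ fun τ hτ => ?_
    refine apriori (by omega) hq (hc.pd i) hf hh i ?_ ?_ hτ
    · intro l s x
      rw [heat_clm (G l) (hf.pd l), hGn]
    · intro x
      have e1 : ∀ l, pd l (dirac γ φ) = fun y => ∑ j, G j (pd l (pd j φ) y) := by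
        intro l
        ext y
        have := pd_sum (fun j => CC.clm (G j) (hc.pd j)) l y
        refine Eq.trans this (Finset.sum_congr rfl fun j _ => ?_)
        exact pd_clm (G j) (hc.pd j) l y
      have e2 : ∀ l, pd i (fun x => G l (pd l (dirac γ φ) x)) x
          = ∑ j, G l (G j (pd i (pd l (pd j φ)) x)) := by
        intro l
        rw [pd_clm (G l) (hf.pd l), e1, pd_sum (fun j => CC.clm (G j) ((hc.pd j).pd l)), map_sum]
        refine Finset.sum_congr rfl fun j _ => ?_
        rw [pd_clm (G j) ((hc.pd j).pd l)]
      have e3 : ∀ j, pd j (pd j (pd i φ)) x = pd i (pd j (pd j φ)) x := by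
        intro j
        rw [pd_comm hc j i, pd_comm (hc.pd j) j i]
      simp only [e2, e3]
      have e4 : ∑ l, ∑ j, G l (G j (pd i (pd l (pd j φ)) x))
          = ∑ l, ∑ j, G j (G l (pd i (pd l (pd j φ)) x)) := by
        rw [Finset.sum_comm]
        refine Finset.sum_congr rfl fun l _ => Finset.sum_congr rfl fun j _ => ?_
        rw [pd_comm hc j l]
      have e5 : ∑ l, ∑ j, G l (G j (pd i (pd l (pd j φ)) x))
          + ∑ l, ∑ j, G j (G l (pd i (pd l (pd j φ)) x))
          = (-2 : ℝ) • ∑ l, pd i (pd l (pd l φ)) x := by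
        rw [← Finset.sum_add_distrib]
        simp only [← Finset.sum_add_distrib, hGG]
        simp [Finset.smul_sum]
      rw [← e4, ← two_smul ℝ, neg_smul, ← smul_neg] at e5
      have := smul_right_injective V (two_ne_zero (α := ℝ)) e5
      rw [this, neg_neg]
  have F0 : 0 ≤ ∫ x, ‖dirac γ φ x‖ ^ q := integral_nonneg fun _ => by positivity
  have hq0 : 0 < q := by linarith
  calc _ ≤ ∑ i : Fin n, C ^ (1 / q) * (∫ x, ‖dirac γ φ x‖ ^ q) ^ (1 / q) := by
        refine Finset.sum_le_sum fun i _ => ?_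
        rw [← Real.mul_rpow hC0 F0]
        exact Real.rpow_le_rpow (integral_nonneg fun _ => by positivity) (main i) (by positivity)
    _ = _ := by simp [mul_assoc]
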